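/- arXiv:1212.0771 — 3 statements merged into one kernel-verified Lean document; each statement's English description precedes it below -/
import Mathlib

section
/- Let k = 2n(ℓ−1) + i with ℓ ≥ 1 and 1 ≤ i ≤ 2n. Under the bijection between symmetric (2n)-cores and balanced flush abaci on 2n runners, the symmetric (2n)-cores with first part exactly k correspond precisely to the balanced flush abaci whose largest bead (the highest-level bead, rightmost among those at the highest level) is located at level ℓ of runner i. -/
/-! Flush abaci with `r` runners, recorded by the level of the lowest bead on each runner
(runners 0-indexed by `Fin r`; entry at level `m` of runner `i` has value `m*(r+1) + (i+1)`). -/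

/-- A balanced abacus on `2n` runners: the levels of symmetric runners sum to zero. -/
def BalancedAbacus (n : ℕ) (a : Fin (2*n) → ℤ) : Prop := ∀ i, a i + a i.rev = 0

/-- `v` is the value of a bead of the flush abacus `a` on `r` runners. -/
def IsBead (r : ℕ) (a : Fin r → ℤ) (v : ℤ) : Prop :=
  ∃ i : Fin r, v % (r+1) = (i : ℤ) + 1 ∧ v ≤ (r+1) * a i + ((i : ℤ) + 1)

/-- `v` is the value of a gap (a non-bead entry) of the abacus `a`. -/
def IsGap (r : ℕ) (a : Fin r → ℤ) (v : ℤ) : Prop :=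
  v % (r+1) ≠ 0 ∧ ¬ IsBead r a v

/-- The core partition of the abacus `a`: row `j` (0-indexed) is the number of gaps smaller
(in reading order) than the bead having exactly `j` beads above it. -/
noncomputable def abacusCore (r : ℕ) (a : Fin r → ℤ) : ℕ → ℕ := fun j =>
  Nat.card {g : ℤ | IsGap r a g ∧ ∃ b : ℤ, IsBead r a b ∧
    Nat.card {b' : ℤ | IsBead r a b' ∧ b < b'} = j ∧ g < b}

/-- Level of runner `i` (0 for an out-of-range index). -/
def aget (r : ℕ) (a : Fin r → ℤ) (i : ℕ) : ℤ := if h : i < r then a ⟨i, h⟩ else 0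

/-- The (0-indexed) position of the rightmost runner whose lowest bead is at the highest level. -/
noncomputable def largestRunner (r : ℕ) (a : Fin r → ℤ) : ℕ :=
  sSup {i : ℕ | ∃ h : i < r, ∀ i', a i' ≤ a ⟨i, h⟩}

def swapIdx (p q x : ℕ) : ℕ := if x = p then q else if x = q then p else x

/-- Action of the Coxeter generator `s_t` (`0 ≤ t ≤ n`) of the affine Weyl group of type `Cₙ`
on balanced flush abaci, in terms of the level vector. -/
def genAct (n : ℕ) (t : ℕ) (a : Fin (2*n) → ℤ) : Fin (2*n) → ℤ := fun x =>
  if t = 0 then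
    if x.val = 0 then aget (2*n) a (2*n-1) + 1
    else if x.val = 2*n-1 then aget (2*n) a 0 - 1
    else a x
  else if t = n then aget (2*n) a (swapIdx (n-1) n x.val)
  else aget (2*n) a (swapIdx (t-1) t (swapIdx (2*n-1-t) (2*n-t) x.val))

/-- Apply a word in the generators to an abacus, leftmost letter first. -/
def applyWord (n : ℕ) (w : List ℕ) (a : Fin (2*n) → ℤ) : Fin (2*n) → ℤ :=
  w.foldl (fun b t => genAct n t b) a

/-- Coxeter length of the minimal coset representative corresponding to the abacus `a`:
the least length of a word in the generators carrying `a` to the identity abacus. -/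
noncomputable def abacusLen (n : ℕ) (a : Fin (2*n) → ℤ) : ℕ :=
  sInf {ℓ : ℕ | ∃ w : List ℕ, (∀ t ∈ w, t ≤ n) ∧ applyWord n w a = 0 ∧ w.length = ℓ}

def skipTwo (p q t : ℕ) : ℕ := if t < p then t else if t + 1 < q then t + 1 else t + 2

/-- Delete runner `j` and its symmetric runner `2n-1-j` from a balanced abacus on `2n` runners
(assuming `2n-1-j < j`), keeping the remaining runners in order with their levels. -/
def deleteRunners (n : ℕ) (a : Fin (2*n) → ℤ) (j : ℕ) : Fin (2*(n-1)) → ℤ :=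
  fun t => aget (2*n) a (skipTwo (2*n-1-j) j t.val)

/-- Delete the single runner `j` from an abacus on `r` runners. -/
def deleteOne (r : ℕ) (a : Fin r → ℤ) (j : ℕ) : Fin (r-1) → ℤ :=
  fun t => aget r a (if t.val < j then t.val else t.val + 1)

theorem isBead_lin (r : ℕ) (a : Fin r → ℤ) (m : ℤ) (j : Fin r) :
    IsBead r a ((r+1) * m + ((j : ℤ) + 1)) ↔ m ≤ a j := by
  have hmod : ((r+1) * m + ((j : ℤ) + 1)) % ((r : ℤ)+1) = (j : ℤ) + 1 := by
    rw [Int.mul_add_emod_self_left]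
    exact Int.emod_eq_of_lt (by omega) (by have := j.2; omega)
  have hr : (0 : ℤ) < (r : ℤ) + 1 := by omega
  constructor
  · rintro ⟨i, h1, h2⟩
    rw [hmod] at h1
    have : j = i := Fin.ext (by omega)
    subst this
    have h3 : ((r : ℤ)+1) * m ≤ (r+1) * a j := by linarith
    exact le_of_mul_le_mul_left h3 hr
  · intro h
    refine ⟨j, hmod, ?_⟩
    have := mul_le_mul_of_nonneg_left h hr.le
    linarith

theorem exists_lin (r : ℕ) (v : ℤ) (hv : v % ((r : ℤ)+1) ≠ 0) :
    ∃ (m : ℤ) (j : Fin r), v = (r+1) * m + ((j : ℤ) + 1) := by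
  have h1 := Int.emod_nonneg v (show ((r : ℤ)+1) ≠ 0 by omega)
  have h2 := Int.emod_lt_of_pos v (show (0 : ℤ) < (r : ℤ)+1 by omega)
  have h3 := Int.mul_ediv_add_emod v ((r : ℤ)+1)
  refine ⟨v / (r+1), ⟨(v % ((r : ℤ)+1) - 1).toNat, by omega⟩, ?_⟩
  have h4 : (((v % ((r : ℤ)+1) - 1).toNat : ℕ) : ℤ) = v % ((r : ℤ)+1) - 1 :=
    Int.toNat_of_nonneg (by omega)
  simp only [h4]
  linarith

/-- Lexicographic comparison of entries. -/
theorem lin_lt (r : ℕ) (m L : ℤ) (j I : Fin r) :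
    (r+1) * m + ((j : ℤ) + 1) < (r+1) * L + ((I : ℤ) + 1) ↔ m < L ∨ (m = L ∧ j < I) := by
  have hj := j.2
  have hI := I.2
  rw [Fin.lt_def]
  rcases lt_trichotomy m L with h | h | h
  · have : (r+1 : ℤ) * (m + 1) ≤ (r+1) * L :=
      mul_le_mul_of_nonneg_left (by omega) (by omega)
    constructor
    · intro _; exact Or.inl h
    · intro _
      rw [mul_add] at this
      omega
  · subst h
    constructor
    · intro h; right; exact ⟨rfl, by omega⟩
    · rintro (h | h)
      · omega
      · omega
  · have : (r+1 : ℤ) * (L + 1) ≤ (r+1) * m :=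
      mul_le_mul_of_nonneg_left (by omega) (by omega)
    rw [mul_add] at this
    constructor
    · intro _; omega
    · intro _; omega

theorem lin_inj (r : ℕ) (m L : ℤ) (j I : Fin r)
    (h : (r+1) * m + ((j : ℤ) + 1) = (r+1) * L + ((I : ℤ) + 1)) : m = L ∧ j = I := by
  have h1 := (lin_lt r m L j I).not.1 (by omega)
  have h2 := (lin_lt r L m I j).not.1 (by omega)
  push Not at h1 h2
  have : m = L := le_antisymm h2.1 h1.1
  exact ⟨this, le_antisymm (h2.2 this.symm) (h1.2 this)⟩

theorem core_zero (r : ℕ) (a : Fin r → ℤ) (hsum : ∑ j, a j = 0) (I : Fin r)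
    (hI : ∀ v, IsBead r a v → v ≤ (r+1) * a I + ((I : ℤ) + 1)) :
    (abacusCore r a 0 : ℤ) = r * (a I - 1) + ((I : ℤ) + 1) := by
  classical
  set B : ℤ := (r+1) * a I + ((I : ℤ) + 1) with hB
  have hbead : IsBead r a B := (isBead_lin r a _ I).2 le_rfl
  let top : Fin r → ℤ := fun j => a I - if I < j then 1 else 0
  have htop : ∀ j, a j ≤ top j := by
    intro j
    have h1 := hI _ ((isBead_lin r a (a j) j).2 le_rfl)
    have h2 := (lin_lt r (a I) (a j) I j).not.1 (by omega)
    push Not at h2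
    simp only [top]
    split_ifs with h
    · rcases h2.1.lt_or_eq with h3 | h3
      · omega
      · exact absurd h (not_lt.2 (h2.2 h3.symm))
    · have := h2.1
      omega
  let S : Finset (Σ _ : Fin r, ℤ) := Finset.univ.sigma fun j => Finset.Ioc (a j) (top j)
  let f : (Σ _ : Fin r, ℤ) → ℤ := fun p => (r+1) * p.2 + ((p.1 : ℤ) + 1)
  have hset : {g : ℤ | IsGap r a g ∧ ∃ b : ℤ, IsBead r a b ∧
      Nat.card {b' : ℤ | IsBead r a b' ∧ b < b'} = 0 ∧ g < b} = ((S.image f : Finset ℤ) : Set ℤ) := by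
    have key : {g : ℤ | IsGap r a g ∧ ∃ b : ℤ, IsBead r a b ∧
      Nat.card {b' : ℤ | IsBead r a b' ∧ b < b'} = 0 ∧ g < b} = {g | IsGap r a g ∧ g < B} := by
      ext g
      simp only [Set.mem_setOf_eq]
      refine and_congr_right fun _ => ⟨?_, ?_⟩
      · rintro ⟨b, h1, -, h3⟩
        exact lt_of_lt_of_le h3 (hI b h1)
      · intro h
        refine ⟨B, hbead, ?_, h⟩
        have : {b' : ℤ | IsBead r a b' ∧ B < b'} = ∅ := by
          ext b'
          simp only [Set.mem_setOf_eq, Set.mem_empty_iff_false, iff_false, not_and, not_lt]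
          exact hI b'
        rw [this]
        simp
    rw [key]
    have hle : ∀ (m : ℤ) (j : Fin r), a j < m →
        ((r+1) * m + ((j : ℤ) + 1) < B ↔ m ≤ top j) := by
      intro m j hm
      rw [hB, lin_lt]
      simp only [top]
      split_ifs with h
      · constructor
        · rintro (h1 | h1)
          · omega
          · exact absurd h1.2 (not_lt.2 h.le)
        · intro h1; left; omega
      · constructor
        · rintro (h1 | h1) <;> omega
        · intro h1
          rcases (show m ≤ a I by omega).lt_or_eq with h2 | h2
          · exact Or.inl h2
          · refine Or.inr ⟨h2, lt_of_le_of_ne (not_lt.1 h) ?_⟩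
            rintro rfl
            omega
    ext g
    simp only [Set.mem_setOf_eq, Finset.coe_image, Set.mem_image, Finset.mem_coe]
    constructor
    · rintro ⟨⟨h1, h2⟩, h3⟩
      obtain ⟨m, j, rfl⟩ := exists_lin r g h1
      rw [isBead_lin, not_le] at h2
      refine ⟨⟨j, m⟩, ?_, rfl⟩
      simp only [S, Finset.mem_sigma, Finset.mem_univ, true_and, Finset.mem_Ioc]
      exact ⟨h2, (hle m j h2).1 h3⟩
    · rintro ⟨⟨j, m⟩, h, rfl⟩
      simp only [S, Finset.mem_sigma, Finset.mem_univ, true_and, Finset.mem_Ioc] at h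
      refine ⟨⟨?_, ?_⟩, (hle m j h.1).2 h.2⟩
      · simp only [f]
        rw [Int.mul_add_emod_self_left, Int.emod_eq_of_lt (by omega) (by have := j.2; omega)]
        omega
      · simp only [f]
        rw [isBead_lin, not_le]
        exact h.1
  have hinj : Set.InjOn f S := by
    rintro ⟨j, m⟩ - ⟨j', m'⟩ - h
    obtain ⟨h1, h2⟩ := lin_inj r m m' j j' h
    subst h1 h2
    rfl
  have hcard : abacusCore r a 0 = ∑ j, (top j - a j).toNat := by
    unfold abacusCore
    rw [hset, Nat.card_coe_set_eq, Set.ncard_coe_finset, Finset.card_image_of_injOn hinj,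
      Finset.card_sigma]
    simp
  rw [hcard]
  push_cast
  have : ∀ j, (((top j - a j).toNat : ℕ) : ℤ) = top j - a j :=
    fun j => Int.toNat_of_nonneg (by have := htop j; omega)
  have hcnt : (Finset.univ.filter fun j : Fin r => I < j).card = r - 1 - I := by
    have h := Fin.card_Ioi I
    rw [← h]
    congr 1
    ext j
    simp
  simp only [Int.toNat_of_nonneg (sub_nonneg.2 (htop _)), Finset.sum_sub_distrib, hsum, top,
    Finset.sum_const, Finset.card_univ, Fintype.card_fin, Finset.sum_boole, hcnt, nsmul_eq_mul]
  have := I.2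
  have h5 : ((r - 1 - (I : ℕ) : ℕ) : ℤ) = r - 1 - I := by omega
  push_cast at h5 ⊢
  rw [h5]
  ring

/-- Write `k = 2n(ℓ-1) + i` with `ℓ ≥ 1`, `1 ≤ i ≤ 2n`.  Under the bijection between
symmetric `2n`-cores and balanced flush abaci on `2n` runners, the cores with first part
exactly `k` correspond precisely to the abaci whose largest bead lies at level `ℓ` of
runner `i`. -/
theorem stmt1 (n k ℓ i : ℕ) (hn : 1 ≤ n) (hℓ : 1 ≤ ℓ) (hi1 : 1 ≤ i) (hi2 : i ≤ 2*n)
    (hk : k = 2*n*(ℓ-1) + i) (a : Fin (2*n) → ℤ) (hbal : BalancedAbacus n a) :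
    abacusCore (2*n) a 0 = k ↔
      (IsBead (2*n) a ((2*n+1) * (ℓ : ℤ) + (i : ℤ)) ∧
       ∀ v : ℤ, IsBead (2*n) a v → v ≤ (2*n+1) * (ℓ : ℤ) + (i : ℤ)) := by
  have hsum : ∑ j, a j = 0 := by
    have h1 : ∑ j, a (Fin.rev j) = ∑ j, a j := Equiv.sum_comp Fin.revPerm a
    have h2 : ∑ j, (a j + a (Fin.rev j)) = 0 := Finset.sum_eq_zero fun j _ => hbal j
    rw [Finset.sum_add_distrib, h1] at h2
    omega
  haveI : Nonempty (Fin (2*n)) := ⟨⟨0, by omega⟩⟩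
  obtain ⟨I, hI⟩ := Finite.exists_max fun j : Fin (2*n) =>
    (((2*n : ℕ) : ℤ)+1) * a j + ((j : ℤ) + 1)
  have hmax : ∀ v, IsBead (2*n) a v → v ≤ (((2*n : ℕ) : ℤ)+1) * a I + ((I : ℤ) + 1) := by
    rintro v ⟨j, -, h⟩
    exact h.trans (hI j)
  have hbead := (isBead_lin (2*n) a (a I) I).2 le_rfl
  have hc := core_zero (2*n) a hsum I hmax
  obtain ⟨i', rfl⟩ : ∃ i', i = i' + 1 := ⟨i - 1, by omega⟩
  obtain ⟨l, rfl⟩ : ∃ l, ℓ = l + 1 := ⟨ℓ - 1, by omega⟩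
  let J : Fin (2*n) := ⟨i', by omega⟩
  have hval : ((2*n+1) * ((l+1 : ℕ) : ℤ) + ((i'+1 : ℕ) : ℤ))
      = (((2*n : ℕ) : ℤ)+1) * ((l : ℤ)+1) + (((J : ℕ) : ℤ) + 1) := by
    simp only [J]; push_cast; ring
  have hk' : (k : ℤ) = ((2*n : ℕ) : ℤ) * l + (((J : ℕ) : ℤ) + 1) := by
    rw [hk]; simp only [J, Nat.add_sub_cancel]; push_cast; ring
  rw [hval]
  have hpin : abacusCore (2*n) a 0 = k ↔ a I = (l : ℤ) + 1 ∧ I = J := by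
    rw [← Nat.cast_inj (R := ℤ), hc, hk']
    constructor
    · intro h
      have h1 := I.2
      have h2 := J.2
      have h3 : a I - 1 = l := by
        have hr : (0 : ℤ) < ((2*n : ℕ) : ℤ) := by omega
        by_contra hne
        rcases lt_or_gt_of_ne hne with h4 | h4
        · have := mul_le_mul_of_nonneg_left (show a I - 1 + 1 ≤ l by omega) hr.le
          rw [mul_add] at this
          omega
        · have := mul_le_mul_of_nonneg_left (show (l : ℤ) + 1 ≤ a I - 1 by omega) hr.le
          rw [mul_add] at this
          omega
      rw [h3] at h
      exact ⟨by omega, Fin.ext (by omega)⟩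
    · rintro ⟨h1, h2⟩
      rw [h1, h2]
      ring
  rw [hpin]
  constructor
  · rintro ⟨h1, h2⟩
    rw [← h1, ← h2]
    exact ⟨hbead, hmax⟩
  · rintro ⟨h1, h2⟩
    exact lin_inj (2*n) _ _ I J (le_antisymm (h2 _ hbead) (hmax _ h1))
end

section
/- The map Φ_n restricted to the set of symmetric (2n)-cores with first part equal to k is a bijection onto the set of symmetric (2n−2)-cores with first part at most k − ⌈k/n⌉. -/
/-! Partitions and cores, represented by their row-length functions `ℕ → ℕ` (0-indexed rows). -/

/-- The length of column `j` (the conjugate partition). -/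
noncomputable def colLen (f : ℕ → ℕ) (j : ℕ) : ℕ := Nat.card {i : ℕ | j < f i}

/-- `f` is a partition: weakly decreasing and eventually zero. -/
def IsPartition (f : ℕ → ℕ) : Prop := Antitone f ∧ ∃ N, ∀ i, N ≤ i → f i = 0

/-- Hook length of the box `(i, j)` (0-indexed). -/
noncomputable def hook (f : ℕ → ℕ) (i j : ℕ) : ℕ := (f i - j) + (colLen f j - i) - 1

/-- `f` is an `m`-core: no hook length of a box of `f` is divisible by `m`. -/
def IsCore (m : ℕ) (f : ℕ → ℕ) : Prop := ∀ i j, j < f i → ¬ (m ∣ hook f i j)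

/-- `f` is symmetric: it equals its conjugate. -/
def IsSymmetric (f : ℕ → ℕ) : Prop := ∀ j, colLen f j = f j

/-- Residue (mod `2n`) of the last box of row `i`, namely `j - i` for `j = f i - 1`. -/
noncomputable def rowRes (n : ℕ) (f : ℕ → ℕ) (i : ℕ) : ZMod (2*n) :=
  (((f i : ℤ) - 1 - (i : ℤ) : ℤ) : ZMod (2*n))

/-- Residue (mod `2n`) of the last box of column `j`. -/
noncomputable def colRes (n : ℕ) (f : ℕ → ℕ) (j : ℕ) : ZMod (2*n) :=
  (((j : ℤ) - ((colLen f j : ℤ) - 1) : ℤ) : ZMod (2*n))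

/-- Row `i` survives: it is nonempty and does not end in the same residue as the first row. -/
noncomputable def keptRow (n : ℕ) (f : ℕ → ℕ) (i : ℕ) : Prop :=
  0 < f i ∧ rowRes n f i ≠ rowRes n f 0

/-- Column `j` survives: it is nonempty and does not end in the same residue as the first column. -/
noncomputable def keptCol (n : ℕ) (f : ℕ → ℕ) (j : ℕ) : Prop :=
  0 < colLen f j ∧ colRes n f j ≠ colRes n f 0

/-- The map `Φₙ` on cores: delete all rows ending in the same residue (mod `2n`) as the
first row and all columns ending in the same residue as the first column.  The `i`-th row of
the result is the number of surviving columns meeting the `i`-th surviving row. -/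
noncomputable def PhiCore (n : ℕ) (f : ℕ → ℕ) : ℕ → ℕ := fun i =>
  Nat.card {j : ℕ | keptRow n f (Nat.nth (keptRow n f) i) ∧ keptCol n f j ∧
    j < f (Nat.nth (keptRow n f) i)}

/-- Delete from `f` all columns ending in the same residue (mod `2n`) as the first column. -/
noncomputable def deleteColsCore (n : ℕ) (f : ℕ → ℕ) : ℕ → ℕ := fun i =>
  Nat.card {j : ℕ | keptCol n f j ∧ j < f i}

/-- Bead (content of the last box) of row `i`. -/
def bd (f : ℕ → ℕ) (i : ℕ) : ℤ := (f i : ℤ) - 1 - i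

/-- The set of beads. -/
def MS (f : ℕ → ℕ) : Set ℤ := Set.range (bd f)

theorem bd_strictAnti {f : ℕ → ℕ} (hf : Antitone f) : StrictAnti (bd f) := by
  apply strictAnti_nat_of_succ_lt
  intro i
  have := hf (Nat.le_succ i)
  unfold bd
  simp only [Nat.succ_eq_add_one] at this
  push_cast
  omega

theorem MS_inj {f g : ℕ → ℕ} (hf : Antitone f) (hg : Antitone g) (h : MS f = MS g) : f = g := by
  have h1 : StrictMono (fun i => - bd f i) := fun a b hab => neg_lt_neg (bd_strictAnti hf hab)
  have h2 : StrictMono (fun i => - bd g i) := fun a b hab => neg_lt_neg (bd_strictAnti hg hab)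
  have h3 : (fun i => - bd f i) = (fun i => - bd g i) := by
    apply (StrictMono.range_inj h1 h2).1
    ext x
    have := Set.ext_iff.1 h (-x)
    simp only [MS, Set.mem_range] at this ⊢
    constructor
    · rintro ⟨y, hy⟩
      obtain ⟨z, hz⟩ := this.1 ⟨y, by omega⟩
      exact ⟨z, by omega⟩
    · rintro ⟨y, hy⟩
      obtain ⟨z, hz⟩ := this.2 ⟨y, by omega⟩
      exact ⟨z, by omega⟩
  funext i
  have := congrFun h3 i
  simp only [bd] at this
  omega

theorem lt_colLen {f : ℕ → ℕ} (hf : IsPartition f) (i j : ℕ) : j < f i ↔ i < colLen f j := by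
  classical
  obtain ⟨ha, N, hN⟩ := hf
  have hex : ∃ i, ¬ j < f i := ⟨N, by simp [hN N le_rfl]⟩
  have hs : {i : ℕ | j < f i} = ((Finset.range (Nat.find hex) : Finset ℕ) : Set ℕ) := by
    ext i
    simp only [Set.mem_ofPred_eq, Finset.coe_range, Set.mem_Iio]
    constructor
    · intro h
      by_contra h'
      have h1 := Nat.find_spec hex
      have := ha (not_lt.1 h')
      omega
    · intro h
      by_contra h'
      exact Nat.find_min hex h h'
  have hc : colLen f j = Nat.find hex := by
    unfold colLen
    rw [hs]
    simp
  rw [hc]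
  have := Set.ext_iff.1 hs i
  simpa using this

theorem pair_compl {f g : ℕ → ℕ} (hf : Antitone f)
    (h : ∀ i j, j < f i ↔ i < g j) (x : ℤ) : x ∈ MS f ↔ -1 - x ∉ MS g := by
  constructor
  · rintro ⟨i, hi⟩ ⟨j, hj⟩
    have := h i j
    unfold bd at hi hj
    omega
  · intro hx
    classical
    by_contra hcon
    have hex : ∃ i : ℕ, bd f i ≤ x := by
      refine ⟨(f 0 + x.natAbs), ?_⟩
      have := hf (Nat.zero_le (f 0 + x.natAbs))
      unfold bd
      omega
    have h1 := Nat.find_spec hex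
    have h2 : ∀ m, m < Nat.find hex → ¬ _ := fun m hm => Nat.find_min hex hm
    generalize Nat.find hex = i at h1 h2
    have h3 : bd f i ≠ x := fun h => hcon ⟨i, h⟩
    unfold bd at h1 h2 h3
    apply hx
    refine ⟨(x + i).toNat, ?_⟩
    unfold bd
    have h4 := h i (x + i).toNat
    rcases Nat.eq_zero_or_pos i with h0 | h0
    · omega
    · have h5 := h2 (i - 1) (by omega)
      have h6 := h (i - 1) (x + i).toNat
      omega

/-- Symmetric partitions, in relational form. -/
def SP (f : ℕ → ℕ) : Prop := Antitone f ∧ ∀ i j, j < f i ↔ i < f j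

theorem SP_iff (f : ℕ → ℕ) : SP f ↔ IsPartition f ∧ IsSymmetric f := by
  constructor
  · rintro ⟨ha, hs⟩
    have hp : IsPartition f := by
      refine ⟨ha, f 0, fun i hi => ?_⟩
      have := hs i 0
      omega
    refine ⟨hp, fun j => ?_⟩
    apply le_antisymm
    · by_contra hc
      have h1 := lt_colLen hp (f j) j
      have h2 := hs (f j) j
      omega
    · by_contra hc
      have h1 := lt_colLen hp (colLen f j) j
      have h2 := hs (colLen f j) j
      omega
  · rintro ⟨hp, hs⟩
    refine ⟨hp.1, fun i j => ?_⟩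
    rw [lt_colLen hp, hs]

theorem SP.compl {f : ℕ → ℕ} (h : SP f) (x : ℤ) : x ∈ MS f ↔ -1 - x ∉ MS f :=
  pair_compl h.1 h.2 x

theorem SP.lt_iff {f : ℕ → ℕ} (h : SP f) (i j : ℕ) : j < f i ↔ 0 < bd f i + bd f j + 1 := by
  have := h.2 i j
  unfold bd
  omega

theorem SP.hook_eq {f : ℕ → ℕ} (h : SP f) (i j : ℕ) (hj : j < f i) :
    (hook f i j : ℤ) = bd f i + bd f j + 1 := by
  have h1 := h.2 i j
  have h2 := ((SP_iff f).1 h).2 j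
  unfold hook bd
  rw [h2]
  omega

theorem iter_mem {S : Set ℤ} {m : ℤ} (h : ∀ x ∈ S, x - m ∈ S) (t : ℕ) :
    ∀ x ∈ S, x - m * t ∈ S := by
  induction t with
  | zero => intro x hx; simpa using hx
  | succ t ih =>
    intro x hx
    have := h _ (ih x hx)
    convert this using 1
    push_cast
    ring

theorem SP.core_iff {f : ℕ → ℕ} (h : SP f) (m : ℕ) (hm : 0 < m) :
    IsCore m f ↔ ∀ x ∈ MS f, x - m ∈ MS f := by
  constructor
  · rintro hc x ⟨i, rfl⟩
    rw [h.compl]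
    rintro ⟨j, hj⟩
    have h1 := h.lt_iff i j
    have h2 : j < f i := by rw [h1]; omega
    apply hc i j h2
    have h3 := h.hook_eq i j h2
    have : hook f i j = m := by omega
    rw [this]
  · rintro hc i j hj ⟨t, ht⟩
    have h3 := h.hook_eq i j hj
    have h1 := iter_mem hc t (bd f i) ⟨i, rfl⟩
    rw [h.compl] at h1
    apply h1
    refine ⟨j, ?_⟩
    rw [ht] at h3
    push_cast at h3
    linarith

theorem exists_of_set (S : Set ℤ) (hS : ∀ x, x ∈ S ↔ -1 - x ∉ S) (K : ℕ)
    (hK : ∀ x ∈ S, x < K) : ∃ f, SP f ∧ MS f = S := by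
  classical
  set p : ℕ → Prop := fun t => (K : ℤ) - 1 - t ∈ S with hp
  have hlarge : ∀ t, 2 * K ≤ t → p t := by
    intro t ht
    simp only [hp]
    rw [hS]
    intro h
    have := hK _ h
    omega
  have hinf : (Set.ofPred p).Infinite := by
    apply Set.infinite_of_not_bddAbove
    rintro ⟨B, hB⟩
    have := hB (hlarge (2 * K + B + 1) (by omega))
    omega
  have hrefl : ∀ t, t < 2 * K → (p (2 * K - 1 - t) ↔ ¬ p t) := by
    intro t ht
    simp only [hp]
    rw [hS]
    have : (-1 - ((K : ℤ) - 1 - ((2 * K - 1 - t : ℕ) : ℤ))) = (K : ℤ) - 1 - t := by omega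
    rw [this]
  have hcount : Nat.count p (2 * K) = K := by
    rw [Nat.count_eq_card_filter_range]
    have h1 : ((Finset.range (2 * K)).filter p).card
        = ((Finset.range (2 * K)).filter (fun t => ¬ p t)).card := by
      apply Finset.card_bij (fun t _ => 2 * K - 1 - t)
      · intro a ha
        simp only [Finset.mem_filter, Finset.mem_range] at ha ⊢
        refine ⟨by omega, ?_⟩
        rw [hrefl a ha.1]
        simpa using ha.2
      · intro a ha b hb hab
        simp only [Finset.mem_filter, Finset.mem_range] at ha hb
        omega
      · intro b hb
        simp only [Finset.mem_filter, Finset.mem_range] at hb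
        refine ⟨2 * K - 1 - b, ?_, by omega⟩
        simp only [Finset.mem_filter, Finset.mem_range]
        exact ⟨by omega, (hrefl b hb.1).2 hb.2⟩
    have h2 : ((Finset.range (2 * K)).filter p).card
        + ((Finset.range (2 * K)).filter (fun t => ¬ p t)).card = 2 * K := by
      have h3 := Finset.card_filter_add_card_filter_not (s := Finset.range (2 * K)) p
      rw [Finset.card_range] at h3
      convert h3
    have h4 : ((Finset.range (2 * K)).filter p).card = K := by omega
    convert h4
  have hcount2 : ∀ d, Nat.count p (2 * K + d) = K + d := by
    intro d
    induction d with
    | zero => simpa using hcount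
    | succ d ih =>
      rw [← Nat.add_assoc, Nat.count_succ, ih, if_pos (hlarge _ (by omega))]
      omega
  have hnthl : ∀ i, K ≤ i → Nat.nth p i = K + i := by
    intro i hi
    have h1 := hcount2 (i - K)
    have h2 := Nat.nth_count (hlarge (2 * K + (i - K)) (by omega))
    rw [h1] at h2
    have h3 : K + (i - K) = i := by omega
    rw [h3] at h2
    omega
  have hmono := Nat.nth_strictMono hinf
  have hle : ∀ d i, Nat.nth p i + d ≤ Nat.nth p (i + d) := by
    intro d i
    induction d with
    | zero => simp
    | succ d ih =>
      have := hmono (Nat.lt_succ_self (i + d))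
      simp only [Nat.succ_eq_add_one] at this
      rw [← Nat.add_assoc i]
      omega
  have hub : ∀ i, Nat.nth p i ≤ K + i := by
    intro i
    rcases le_total K i with h | h
    · exact (hnthl i h).le
    · have h1 := hle (K - i) i
      have h2 := hnthl K le_rfl
      have h3 : i + (K - i) = K := by omega
      rw [h3] at h1
      omega
  let f : ℕ → ℕ := fun i => K + i - Nat.nth p i
  have hfa : Antitone f := by
    apply antitone_nat_of_succ_le
    intro i
    have := hle 1 i
    simp only [f]
    omega
  have hbd : ∀ i, bd f i = (K : ℤ) - 1 - Nat.nth p i := by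
    intro i
    have := hub i
    simp only [bd, f]
    omega
  have hfS : MS f = S := by
    ext x
    constructor
    · rintro ⟨i, rfl⟩
      rw [hbd]
      exact Nat.nth_mem_of_infinite hinf i
    · intro hx
      have hxK := hK x hx
      have hpx : p ((K : ℤ) - 1 - x).toNat := by
        simp only [hp]
        convert hx using 1
        omega
      refine ⟨Nat.count p ((K : ℤ) - 1 - x).toNat, ?_⟩
      rw [hbd, Nat.nth_count hpx]
      omega
  have hfp : IsPartition f := by
    refine ⟨hfa, K, fun i hi => ?_⟩
    simp only [f, hnthl i hi]
    omega
  have hga : Antitone (colLen f) := by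
    intro a b hab
    by_contra hc
    have h1 := lt_colLen hfp (colLen f a) a
    have h2 := lt_colLen hfp (colLen f a) b
    omega
  have hcf : colLen f = f := by
    apply MS_inj hga hfa
    ext x
    rw [pair_compl hga (g := f) (fun i j => (lt_colLen hfp j i).symm), hfS]
    exact (hS x).symm
  refine ⟨f, ⟨hfa, fun i j => ?_⟩, hfS⟩
  rw [lt_colLen hfp, hcf]

/-- The order embedding of `ℤ` onto the complement of two complementary residue classes. -/
def psi (n a : ℤ) (y : ℤ) : ℤ := y + (y - a) / (2 * n - 2) + 1 + (y + a) / (2 * n - 2)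

theorem psi_strictMono {n a : ℤ} (hn : 2 ≤ n) : StrictMono (psi n a) := by
  intro x y hxy
  unfold psi
  have h1 : (x - a) / (2 * n - 2) ≤ (y - a) / (2 * n - 2) :=
    Int.ediv_le_ediv (by omega) (by omega)
  have h2 : (x + a) / (2 * n - 2) ≤ (y + a) / (2 * n - 2) :=
    Int.ediv_le_ediv (by omega) (by omega)
  omega

theorem ediv_eq_of {x N q : ℤ} (h1 : N * q ≤ x) (h2 : x < N * q + N) : x / N = q := by
  have hN : 0 < N := by linarith
  rw [Int.ediv_eq_iff_of_pos hN]
  constructor <;> linarith [mul_comm N q, mul_comm q N]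

theorem neg_one_sub_ediv {x N : ℤ} (hN : 0 < N) : (-1 - x) / N = -1 - x / N := by
  have h1 := Int.mul_ediv_add_emod x N
  have h2 := Int.emod_nonneg x hN.ne'
  have h3 := Int.emod_lt_of_pos x hN
  apply ediv_eq_of
  · have : N * (-1 - x / N) = -N - N * (x / N) := by ring
    omega
  · have : N * (-1 - x / N) = -N - N * (x / N) := by ring
    omega

theorem psi_neg {n a : ℤ} (hn : 2 ≤ n) (y : ℤ) : psi n a (-1 - y) = -1 - psi n a y := by
  unfold psi
  have e1 : -1 - y - a = -1 - (y + a) := by ring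
  have e2 : -1 - y + a = -1 - (y - a) := by ring
  rw [e1, e2, neg_one_sub_ediv (by omega), neg_one_sub_ediv (by omega)]
  ring

theorem psi_add {n a : ℤ} (hn : 2 ≤ n) (y : ℤ) (q : ℤ) :
    psi n a (y + (2 * n - 2) * q) = psi n a y + 2 * n * q := by
  unfold psi
  have e1 : y + (2 * n - 2) * q - a = (y - a) + (2 * n - 2) * q := by ring
  have e2 : y + (2 * n - 2) * q + a = (y + a) + (2 * n - 2) * q := by ring
  rw [e1, e2, Int.add_mul_ediv_left _ _ (by omega), Int.add_mul_ediv_left _ _ (by omega)]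
  ring

theorem psi_small {n a s : ℤ} (hn : 2 ≤ n) (ha : 0 ≤ a) (han : a < n) (hs : 0 ≤ s)
    (hs' : s < 2 * n - 2) :
    psi n a s = s + (if a ≤ s then 1 else 0) + (if 2 * n - 2 - a ≤ s then 1 else 0) := by
  unfold psi
  have h1 : (s - a) / (2 * n - 2) = if a ≤ s then 0 else -1 := by
    split_ifs <;> apply ediv_eq_of <;> omega
  have h2 : (s + a) / (2 * n - 2) = if 2 * n - 2 - a ≤ s then 1 else 0 := by
    split_ifs <;> apply ediv_eq_of <;> omega
  rw [h1, h2]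
  split_ifs <;> omega

theorem small_dvd {n s a : ℤ} (hs : 0 ≤ s) (hs' : s < 2 * n) (ha : 0 ≤ a) (han : a < 2 * n) :
    2 * n ∣ s - a ↔ s = a := by
  constructor
  · intro h
    have := Int.eq_zero_of_abs_lt_dvd h (by rw [abs_lt]; omega)
    omega
  · rintro rfl
    simp

theorem psi_range {n a : ℤ} (hn : 2 ≤ n) (ha : 0 ≤ a) (han : a < n) (x : ℤ) :
    (∃ y, psi n a y = x) ↔ ¬ 2 * n ∣ x - a ∧ ¬ 2 * n ∣ x + a + 1 := by
  have key : ∀ q s : ℤ, 0 ≤ s → s < 2 * n →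
      ((¬ 2 * n ∣ s + 2 * n * q - a ∧ ¬ 2 * n ∣ s + 2 * n * q + a + 1) ↔
        s ≠ a ∧ s ≠ 2 * n - 1 - a) := by
    intro q s hs hs'
    have e1 : s + 2 * n * q - a = (s - a) + 2 * n * q := by ring
    have e2 : s + 2 * n * q + a + 1 = (s - (2 * n - 1 - a)) + 2 * n * (q + 1) := by ring
    rw [e1, e2, dvd_add_left (dvd_mul_right _ _), dvd_add_left (dvd_mul_right _ _),
      small_dvd hs hs' (by omega) (by omega), small_dvd hs hs' (by omega) (by omega)]
  constructor
  · rintro ⟨y, rfl⟩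
    have h1 := Int.emod_add_mul_ediv y (2 * n - 2)
    have h2 := Int.emod_nonneg y (b := 2 * n - 2) (by omega)
    have h3 := Int.emod_lt_of_pos y (b := 2 * n - 2) (by omega)
    rw [← h1, psi_add hn, psi_small hn ha han h2 h3]
    generalize y % (2 * n - 2) = s at h2 h3
    rw [key]
    · split_ifs <;> omega
    · split_ifs <;> omega
    · split_ifs <;> omega
  · intro h
    have h1 := Int.emod_add_mul_ediv x (2 * n)
    have h2 := Int.emod_nonneg x (b := 2 * n) (by omega)
    have h3 := Int.emod_lt_of_pos x (b := 2 * n) (by omega)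
    generalize x / (2 * n) = q at h1
    generalize x % (2 * n) = s at h1 h2 h3
    subst h1
    rw [key q s h2 h3] at h
    refine ⟨(s - (if a < s then 1 else 0) - (if 2 * n - 1 - a < s then 1 else 0))
      + (2 * n - 2) * q, ?_⟩
    rw [psi_add hn, psi_small hn ha han]
    · split_ifs <;> omega
    · split_ifs <;> omega
    · split_ifs <;> omega

theorem exists_psi (n k : ℕ) (hn : 2 ≤ n) (hk : 1 ≤ k) : ∃ ψ : ℤ → ℤ, StrictMono ψ ∧
    (∀ y, ψ (-1 - y) = -1 - ψ y) ∧ (∀ y, ψ (y - (2 * n - 2 : ℕ)) = ψ y - (2 * n : ℕ)) ∧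
    (∀ x, (∃ y, ψ y = x) ↔
      ¬ ((2 * n : ℕ) : ℤ) ∣ x - (k - 1) ∧ ¬ ((2 * n : ℕ) : ℤ) ∣ x + k) ∧
    (∀ y, ψ y < k ↔ y < (k - (k + n - 1) / n : ℕ)) := by
  have hn' : (2 : ℤ) ≤ n := by exact_mod_cast hn
  obtain ⟨q, r, hqr, hr⟩ : ∃ q r : ℕ, k - 1 = 2 * n * q + r ∧ r < 2 * n :=
    ⟨(k - 1) / (2 * n), (k - 1) % (2 * n), (Nat.div_add_mod _ _).symm, Nat.mod_lt _ (by omega)⟩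
  have cast1 : ((2 * n - 2 : ℕ) : ℤ) = 2 * n - 2 := by omega
  have cast2 : ((2 * n : ℕ) : ℤ) = 2 * n := by push_cast; ring
  have hkz : (k : ℤ) = 2 * n * q + r + 1 := by
    have : k = 2 * n * q + r + 1 := by omega
    rw [this]; push_cast; ring
  have common : ∀ a : ℤ, 0 ≤ a → a < n → ∀ y,
      psi n a (y - (2 * n - 2 : ℕ)) = psi n a y - (2 * n : ℕ) := by
    intro a ha han y
    have := psi_add (a := a) hn' y (-1)
    rw [cast1, cast2]
    convert this using 1
    · congr 1; ring
    · ring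
  have fin : ∀ a K' : ℤ, psi n a (K' - 1) < k → (k : ℤ) ≤ psi n a K' →
      ∀ y, psi n a y < k ↔ y < K' := by
    intro a K' h1 h2 y
    have hm := psi_strictMono (a := a) hn'
    constructor
    · intro h
      exact hm.lt_iff_lt.1 (lt_of_lt_of_le h h2)
    · intro h
      have : psi n a y ≤ psi n a (K' - 1) := hm.monotone (by omega)
      omega
  rcases lt_or_ge r n with hrn | hrn
  · have hceil : (k + n - 1) / n = 2 * q + 1 := by
      have : k + n - 1 = r + n * (2 * q + 1) := by
        have : n * (2 * q + 1) = 2 * n * q + n := by ring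
        omega
      rw [this, Nat.add_mul_div_left _ _ (by omega), Nat.div_eq_of_lt hrn]
      omega
    have hK' : ((k - (k + n - 1) / n : ℕ) : ℤ) = r + (2 * n - 2) * q := by
      have h1 : (k + n - 1) / n ≤ k := by
        rw [hceil]
        have : 2 * q ≤ 2 * n * q := by nlinarith
        omega
      rw [Nat.cast_sub h1, hceil, hkz]
      push_cast
      ring
    refine ⟨psi n r, psi_strictMono hn', psi_neg hn', common r (by omega) (by omega), ?_, ?_⟩
    · intro x
      rw [psi_range hn' (by omega) (by omega), cast2, hkz]
      have e1 : x - (2 * n * q + r + 1 - 1 : ℤ) = (x - r) + 2 * n * (-q) := by ring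
      have e2 : x + (2 * n * q + r + 1 : ℤ) = (x + r + 1) + 2 * n * q := by ring
      rw [e1, e2, dvd_add_left (dvd_mul_right _ _), dvd_add_left (dvd_mul_right _ _)]
    · rw [hK']
      apply fin
      · have e : (r + (2 * n - 2) * q - 1 : ℤ) = (r - 1) + (2 * n - 2) * q := by ring
        rw [e, psi_add hn', hkz]
        have : psi n r (r - 1) < r + 1 := by
          unfold psi
          have h1 : ((r : ℤ) - 1 - r) / (2 * n - 2) = -1 := by
            apply ediv_eq_of <;> omega
          have h2 : ((r : ℤ) - 1 + r) / (2 * n - 2) < 1 :=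
            Int.ediv_lt_of_lt_mul (by omega) (by omega)
          omega
        linarith
      · rw [psi_add hn', hkz]
        have : (r : ℤ) + 1 ≤ psi n r r := by
          unfold psi
          have h1 : ((r : ℤ) - r) / (2 * n - 2) = 0 := by simp
          have h2 : 0 ≤ ((r : ℤ) + r) / (2 * n - 2) := Int.ediv_nonneg (by omega) (by omega)
          omega
        linarith
  · obtain ⟨a, ha⟩ : ∃ a : ℕ, r + a = 2 * n - 1 := ⟨2 * n - 1 - r, by omega⟩
    have hra : (r : ℤ) = 2 * n - 1 - a := by omega
    have hceil : (k + n - 1) / n = 2 * q + 2 := by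
      have : k + n - 1 = (r - n) + n * (2 * q + 2) := by
        have : n * (2 * q + 2) = 2 * n * q + 2 * n := by ring
        omega
      rw [this, Nat.add_mul_div_left _ _ (by omega), Nat.div_eq_of_lt (by omega)]
      omega
    have hK' : ((k - (k + n - 1) / n : ℕ) : ℤ) = -a + (2 * n - 2) * (q + 1) := by
      have h1 : (k + n - 1) / n ≤ k := by
        rw [hceil]
        have : 2 * q ≤ 2 * n * q := by nlinarith
        omega
      rw [Nat.cast_sub h1, hceil, hkz, hra]
      push_cast
      ring
    refine ⟨psi n a, psi_strictMono hn', psi_neg hn', common a (by omega) (by omega), ?_, ?_⟩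
    · intro x
      rw [psi_range hn' (by omega) (by omega), cast2, hkz, hra]
      have e1 : x - (2 * n * q + (2 * n - 1 - a) + 1 - 1 : ℤ)
        = (x + a + 1) + 2 * n * (-q - 1) := by ring
      have e2 : x + (2 * n * q + (2 * n - 1 - a) + 1 : ℤ) = (x - a) + 2 * n * (q + 1) := by ring
      rw [e1, e2, dvd_add_left (dvd_mul_right _ _), dvd_add_left (dvd_mul_right _ _), and_comm]
    · rw [hK']
      apply fin
      · have e : (-a + (2 * n - 2) * (q + 1) - 1 : ℤ) = (-a - 1) + (2 * n - 2) * (q + 1) := by ring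
        rw [e, psi_add hn', hkz, hra]
        have : psi n a (-a - 1) < -a := by
          unfold psi
          have h1 : (-(a : ℤ) - 1 + a) / (2 * n - 2) = -1 := by
            apply ediv_eq_of <;> omega
          have h2 : (-(a : ℤ) - 1 - a) / (2 * n - 2) < 0 :=
            Int.ediv_lt_of_lt_mul (by omega) (by omega)
          omega
        linarith
      · rw [psi_add hn', hkz, hra]
        have : -(a : ℤ) ≤ psi n a (-a) := by
          unfold psi
          have h1 : (-(a : ℤ) + a) / (2 * n - 2) = 0 := by simp
          have h2 : -1 ≤ (-(a : ℤ) - a) / (2 * n - 2) := by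
            rw [Int.le_ediv_iff_mul_le (by omega)]
            omega
          omega
        linarith

theorem bd_zero_max {f : ℕ → ℕ} (h : SP f) {x : ℤ} (hx : x ∈ MS f) : x ≤ f 0 - 1 := by
  obtain ⟨i, rfl⟩ := hx
  have := h.1 (Nat.zero_le i)
  unfold bd
  omega

theorem bd_zero_mem (f : ℕ → ℕ) : (f 0 : ℤ) - 1 ∈ MS f := ⟨0, by simp [bd]⟩

/-- On the class of the largest bead, the bead set of a core is explicit. -/
theorem class_top {f : ℕ → ℕ} (h : SP f) {m : ℕ} (hm : 0 < m) (hc : ∀ x ∈ MS f, x - m ∈ MS f)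
    {x : ℤ} (hx : (m : ℤ) ∣ x - (f 0 - 1)) : x ∈ MS f ↔ x ≤ f 0 - 1 := by
  constructor
  · exact bd_zero_max h
  · intro hle
    obtain ⟨t, ht⟩ := hx
    have hm' : (0 : ℤ) < m := by exact_mod_cast hm
    have htn : t ≤ 0 := by
      by_contra hcon
      have : 0 < (m : ℤ) * t := mul_pos hm' (by omega)
      omega
    have := iter_mem hc (-t).toNat _ (bd_zero_mem f)
    convert this using 1
    have e : (((-t).toNat : ℕ) : ℤ) = -t := by omega
    rw [e]
    linarith

theorem class_bot {f : ℕ → ℕ} (h : SP f) {m : ℕ} (hm : 0 < m) (hc : ∀ x ∈ MS f, x - m ∈ MS f)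
    {x : ℤ} (hx : (m : ℤ) ∣ x + f 0) : x ∈ MS f ↔ x < - f 0 := by
  rw [h.compl, class_top h hm hc]
  · omega
  · have : -1 - x - ((f 0 : ℤ) - 1) = -(x + f 0) := by ring
    rw [this]
    exact (dvd_neg).2 hx

theorem rowRes_eq_iff (n : ℕ) (f : ℕ → ℕ) (i : ℕ) :
    rowRes n f i = rowRes n f 0 ↔ ((2 * n : ℕ) : ℤ) ∣ bd f i - (f 0 - 1) := by
  unfold rowRes
  rw [← sub_eq_zero, ← Int.cast_sub, ZMod.intCast_zmod_eq_zero_iff_dvd]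
  simp [bd]

theorem colRes_eq_iff {n : ℕ} {f : ℕ → ℕ} (h : SP f) (i : ℕ) :
    colRes n f i = colRes n f 0 ↔ rowRes n f i = rowRes n f 0 := by
  rw [rowRes_eq_iff]
  have hs := ((SP_iff f).1 h).2
  unfold colRes
  rw [← sub_eq_zero, ← Int.cast_sub, ZMod.intCast_zmod_eq_zero_iff_dvd, hs, hs, ← dvd_neg]
  apply iff_of_eq
  congr 1
  simp only [bd]
  push_cast
  ring

theorem keptCol_iff {n : ℕ} {f : ℕ → ℕ} (h : SP f) (i : ℕ) : keptCol n f i ↔ keptRow n f i := by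
  unfold keptCol keptRow
  rw [((SP_iff f).1 h).2, ne_eq, colRes_eq_iff h]

theorem Phi_eq {n : ℕ} (hn : 2 ≤ n) {f g : ℕ → ℕ} (hf : SP f) (hg : SP g)
    (hc : ∀ x ∈ MS f, x - (2 * n : ℕ) ∈ MS f) {ψ : ℤ → ℤ} (hψ : StrictMono ψ)
    (hneg : ∀ y, ψ (-1 - y) = -1 - ψ y)
    (hrange : ∀ x, (∃ y, ψ y = x) ↔
      ¬ ((2 * n : ℕ) : ℤ) ∣ x - (f 0 - 1) ∧ ¬ ((2 * n : ℕ) : ℤ) ∣ x + f 0)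
    (hfg : ∀ y, y ∈ MS g ↔ ψ y ∈ MS f) : PhiCore n f = g := by
  classical
  have ht : ∀ j, ∃ i, bd f i = ψ (bd g j) := fun j => (hfg _).1 ⟨j, rfl⟩
  choose t ht using ht
  have hbf := bd_strictAnti hf.1
  have hbg := bd_strictAnti hg.1
  have htm : StrictMono t := by
    intro a b hab
    rw [← hbf.lt_iff_gt, ht, ht]
    exact hψ (hbg hab)
  have hlt : ∀ i j, t j < f (t i) ↔ j < g i := by
    intro i j
    rw [hf.lt_iff, hg.lt_iff, ht, ht]
    have h1 : ψ (-1 - bd g j) < ψ (bd g i) ↔ -1 - bd g j < bd g i := hψ.lt_iff_lt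
    rw [hneg] at h1
    constructor
    · intro h; have := h1.1 (by omega); omega
    · intro h; have := h1.2 (by omega); omega
  have hkept : ∀ i, keptRow n f i ↔ (∃ j, t j = i) ∧ 0 < f i := by
    intro i
    unfold keptRow
    rw [ne_eq, rowRes_eq_iff]
    constructor
    · rintro ⟨h0, h1⟩
      refine ⟨?_, h0⟩
      have h2 : ¬ ((2 * n : ℕ) : ℤ) ∣ bd f i + f 0 := by
        intro h2
        have h3 := (class_bot hf (by omega) hc h2).1 ⟨i, rfl⟩
        have h4 := (hf.lt_iff i 0).1 h0
        simp only [bd] at h3 h4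
        push_cast at h4
        omega
      obtain ⟨y, hy⟩ := (hrange _).2 ⟨h1, h2⟩
      have hyg : y ∈ MS g := by rw [hfg, hy]; exact ⟨i, rfl⟩
      obtain ⟨j, hj⟩ := hyg
      refine ⟨j, hbf.injective ?_⟩
      rw [ht, hj, hy]
    · rintro ⟨⟨j, rfl⟩, h0⟩
      refine ⟨h0, ?_⟩
      rw [ht]
      exact ((hrange _).1 ⟨_, rfl⟩).1
  have hnot0 : ¬ keptRow n f 0 := fun h => h.2 rfl
  funext i
  unfold PhiCore
  rcases Nat.eq_zero_or_pos (f (t i)) with h0 | h0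
  · have hgi : g i = 0 := by
      have := hlt i 0
      omega
    have hsub : (Set.ofPred (keptRow n f)) ⊆ ((Finset.range i).image t : Finset ℕ) := by
      intro x hx
      obtain ⟨⟨j, rfl⟩, hj⟩ := (hkept x).1 hx
      simp only [Finset.coe_image, Finset.coe_range, Set.mem_image, Set.mem_Iio]
      refine ⟨j, ?_, rfl⟩
      by_contra hcon
      have := hf.1 (htm.monotone (not_lt.1 hcon))
      omega
    have hfin : (Set.ofPred (keptRow n f)).Finite := (Finset.finite_toSet _).subset hsub
    have hcard : hfin.toFinset.card ≤ i := by
      calc hfin.toFinset.card ≤ ((Finset.range i).image t).card := by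
            apply Finset.card_le_card
            intro x hx
            exact_mod_cast hsub (by simpa using hx)
        _ ≤ (Finset.range i).card := Finset.card_image_le
        _ = i := Finset.card_range i
    rw [Nat.nth_of_card_le hfin hcard]
    simp [hnot0, hgi]
  · have hnth : Nat.nth (keptRow n f) i = t i := by
      have hk : keptRow n f (t i) := (hkept _).2 ⟨⟨i, rfl⟩, h0⟩
      have h1 := Nat.nth_count hk
      have h2 : Nat.count (keptRow n f) (t i) = i := by
        rw [Nat.count_eq_card_filter_range]
        have : (Finset.range (t i)).filter (keptRow n f) = (Finset.range i).image t := by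
          ext x
          simp only [Finset.mem_filter, Finset.mem_range, Finset.mem_image, hkept]
          constructor
          · rintro ⟨hx, ⟨j, rfl⟩, -⟩
            exact ⟨j, htm.lt_iff_lt.1 hx, rfl⟩
          · rintro ⟨j, hj, rfl⟩
            refine ⟨htm hj, ⟨j, rfl⟩, ?_⟩
            have := hf.1 (htm hj).le
            omega
        rw [this, Finset.card_image_of_injective _ htm.injective, Finset.card_range]
      rw [h2] at h1
      exact h1
    rw [hnth]
    have hset : {j : ℕ | keptRow n f (t i) ∧ keptCol n f j ∧ j < f (t i)}
        = ((Finset.range (g i)).image t : Finset ℕ) := by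
      ext x
      simp only [Set.mem_ofPred_eq, Finset.coe_image, Finset.coe_range, Set.mem_image, Set.mem_Iio,
        keptCol_iff hf, hkept]
      constructor
      · rintro ⟨-, ⟨⟨j, rfl⟩, -⟩, hj⟩
        exact ⟨j, (hlt i j).1 hj, rfl⟩
      · rintro ⟨j, hj, rfl⟩
        have h1 := (hlt i j).2 hj
        have h2 := (hf.2 (t i) (t j)).1 h1
        exact ⟨⟨⟨i, rfl⟩, h0⟩, ⟨⟨j, rfl⟩, by omega⟩, h1⟩
    rw [hset]
    simp [Finset.card_image_of_injective _ htm.injective]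

/-- `Φₙ` restricted to symmetric `2n`-cores with first part `k` is a bijection onto the
symmetric `(2n-2)`-cores with first part at most `k - ⌈k/n⌉`. -/
theorem stmt2 (n k : ℕ) (hn : 2 ≤ n) (hk : 1 ≤ k) :
    Set.BijOn (PhiCore n)
      {f : ℕ → ℕ | IsPartition f ∧ IsCore (2*n) f ∧ IsSymmetric f ∧ f 0 = k}
      {f : ℕ → ℕ | IsPartition f ∧ IsCore (2*n-2) f ∧ IsSymmetric f ∧
        f 0 ≤ k - (k + n - 1)/n} := by
  obtain ⟨ψ, hψ, hneg, hper, hrange, hbound⟩ := exists_psi n k hn hk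
  have hsrc : ∀ f, (IsPartition f ∧ IsCore (2*n) f ∧ IsSymmetric f ∧ f 0 = k) ↔
      (SP f ∧ (∀ x ∈ MS f, x - (2 * n : ℕ) ∈ MS f) ∧ f 0 = k) := by
    intro f
    constructor
    · rintro ⟨h1, h2, h3, h4⟩
      have h := (SP_iff f).2 ⟨h1, h3⟩
      exact ⟨h, (h.core_iff _ (by omega)).1 h2, h4⟩
    · rintro ⟨h, h2, h4⟩
      have h' := (SP_iff f).1 h
      exact ⟨h'.1, (h.core_iff _ (by omega)).2 h2, h'.2, h4⟩
  have htgt : ∀ f, (IsPartition f ∧ IsCore (2*n-2) f ∧ IsSymmetric f ∧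
        f 0 ≤ k - (k + n - 1)/n) ↔
      (SP f ∧ (∀ x ∈ MS f, x - (2 * n - 2 : ℕ) ∈ MS f) ∧ f 0 ≤ k - (k + n - 1)/n) := by
    intro f
    constructor
    · rintro ⟨h1, h2, h3, h4⟩
      have h := (SP_iff f).2 ⟨h1, h3⟩
      exact ⟨h, (h.core_iff _ (by omega)).1 h2, h4⟩
    · rintro ⟨h, h2, h4⟩
      have h' := (SP_iff f).1 h
      exact ⟨h'.1, (h.core_iff _ (by omega)).2 h2, h'.2, h4⟩
  have hfwd : ∀ f, SP f → (∀ x ∈ MS f, x - (2 * n : ℕ) ∈ MS f) → f 0 = k →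
      SP (PhiCore n f) ∧ ∀ y, y ∈ MS (PhiCore n f) ↔ ψ y ∈ MS f := by
    intro f hf hc h0
    obtain ⟨g, hg, hgS⟩ := exists_of_set {y | ψ y ∈ MS f}
      (fun y => by
        simp only [Set.mem_ofPred_eq]
        rw [hneg]
        exact hf.compl _)
      (k - (k + n - 1) / n)
      (fun y hy => by
        rw [← hbound]
        have := bd_zero_max hf hy
        omega)
    have hfg : ∀ y, y ∈ MS g ↔ ψ y ∈ MS f := by
      intro y; rw [hgS]; rfl
    have := Phi_eq hn hf hg hc hψ hneg (by rw [h0]; exact hrange) hfg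
    rw [this]
    exact ⟨hg, hfg⟩
  refine ⟨?_, ?_, ?_⟩
  · intro f hf
    obtain ⟨hf, hc, h0⟩ := (hsrc f).1 hf
    obtain ⟨hg, hfg⟩ := hfwd f hf hc h0
    refine (htgt _).2 ⟨hg, ?_, ?_⟩
    · intro y hy
      rw [hfg] at hy ⊢
      rw [hper]
      exact hc _ hy
    · have h1 := (hfg _).1 (bd_zero_mem (PhiCore n f))
      have h2 := bd_zero_max hf h1
      have h3 := (hbound ((PhiCore n f 0 : ℤ) - 1)).1 (by omega)
      omega
  · intro f1 hf1 f2 hf2 heq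
    obtain ⟨hf1, hc1, h01⟩ := (hsrc f1).1 hf1
    obtain ⟨hf2, hc2, h02⟩ := (hsrc f2).1 hf2
    obtain ⟨-, hfg1⟩ := hfwd f1 hf1 hc1 h01
    obtain ⟨-, hfg2⟩ := hfwd f2 hf2 hc2 h02
    rw [heq] at hfg1
    apply MS_inj hf1.1 hf2.1
    ext x
    by_cases hx1 : ((2 * n : ℕ) : ℤ) ∣ x - (k - 1)
    · rw [class_top hf1 (by omega) hc1 (by rw [h01]; exact hx1),
        class_top hf2 (by omega) hc2 (by rw [h02]; exact hx1), h01, h02]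
    · by_cases hx2 : ((2 * n : ℕ) : ℤ) ∣ x + k
      · rw [class_bot hf1 (by omega) hc1 (by rw [h01]; exact hx2),
          class_bot hf2 (by omega) hc2 (by rw [h02]; exact hx2), h01, h02]
      · obtain ⟨y, rfl⟩ := (hrange x).2 ⟨hx1, hx2⟩
        rw [← hfg1, ← hfg2]
  · intro g hg
    obtain ⟨hg, hcg, hg0⟩ := (htgt g).1 hg
    let S : Set ℤ := {x | (∃ y ∈ MS g, ψ y = x) ∨
      (((2 * n : ℕ) : ℤ) ∣ x - (k - 1) ∧ x ≤ k - 1) ∨ (((2 * n : ℕ) : ℤ) ∣ x + k ∧ x < -k)}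
    have hexcl : ∀ x : ℤ, ((2 * n : ℕ) : ℤ) ∣ x - (k - 1) → ((2 * n : ℕ) : ℤ) ∣ x + k → False := by
      intro x h1 h2
      have h3 := dvd_trans (show (2 : ℤ) ∣ ((2 * n : ℕ) : ℤ) from ⟨n, by push_cast; ring⟩)
        (dvd_sub h2 h1)
      omega
    have hSψ : ∀ y, ψ y ∈ S ↔ y ∈ MS g := by
      intro y
      have hy := (hrange (ψ y)).1 ⟨y, rfl⟩
      constructor
      · rintro (⟨z, hz, hzy⟩ | ⟨h, -⟩ | ⟨h, -⟩)
        · rwa [← hψ.injective hzy]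
        · exact absurd h hy.1
        · exact absurd h hy.2
      · intro h
        exact Or.inl ⟨y, h, rfl⟩
    have hS1 : ∀ x : ℤ, ((2 * n : ℕ) : ℤ) ∣ x - (k - 1) → (x ∈ S ↔ x ≤ k - 1) := by
      intro x hx
      constructor
      · rintro (⟨z, hz, hzy⟩ | ⟨-, h⟩ | ⟨h, -⟩)
        · exact absurd hx ((hrange x).1 ⟨z, hzy⟩).1
        · exact h
        · exact (hexcl x hx h).elim
      · intro h
        exact Or.inr (Or.inl ⟨hx, h⟩)
    have hS2 : ∀ x : ℤ, ((2 * n : ℕ) : ℤ) ∣ x + k → (x ∈ S ↔ x < -k) := by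
      intro x hx
      constructor
      · rintro (⟨z, hz, hzy⟩ | ⟨h, -⟩ | ⟨-, h⟩)
        · exact absurd hx ((hrange x).1 ⟨z, hzy⟩).2
        · exact (hexcl x h hx).elim
        · exact h
      · intro h
        exact Or.inr (Or.inr ⟨hx, h⟩)
    have hSlt : ∀ x ∈ S, x < (k : ℤ) := by
      rintro x (⟨y, hy, rfl⟩ | ⟨-, h⟩ | ⟨-, h⟩)
      · rw [hbound]
        have := bd_zero_max hg hy
        omega
      · omega
      · omega
    have hSsym : ∀ x, x ∈ S ↔ -1 - x ∉ S := by
      intro x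
      by_cases hx1 : ((2 * n : ℕ) : ℤ) ∣ x - (k - 1)
      · have hx1' : ((2 * n : ℕ) : ℤ) ∣ (-1 - x) + k := by
          have e : (-1 - x) + (k : ℤ) = -(x - (k - 1)) := by ring
          rw [e]; exact dvd_neg.2 hx1
        rw [hS1 x hx1, hS2 _ hx1']
        omega
      · by_cases hx2 : ((2 * n : ℕ) : ℤ) ∣ x + k
        · have hx2' : ((2 * n : ℕ) : ℤ) ∣ (-1 - x) - (k - 1) := by
            have e : (-1 - x) - ((k : ℤ) - 1) = -(x + k) := by ring
            rw [e]; exact dvd_neg.2 hx2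
          rw [hS2 x hx2, hS1 _ hx2']
          omega
        · obtain ⟨y, rfl⟩ := (hrange x).2 ⟨hx1, hx2⟩
          rw [← hneg, hSψ, hSψ]
          exact hg.compl y
    have hScore : ∀ x ∈ S, x - (2 * n : ℕ) ∈ S := by
      rintro x (⟨y, hy, rfl⟩ | ⟨h, h'⟩ | ⟨h, h'⟩)
      · rw [← hper, hSψ]
        exact hcg y hy
      · refine Or.inr (Or.inl ⟨?_, by omega⟩)
        have e : x - (2 * n : ℕ) - ((k : ℤ) - 1) = (x - (k - 1)) - (2 * n : ℕ) := by ring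
        rw [e]
        exact dvd_sub h dvd_rfl
      · refine Or.inr (Or.inr ⟨?_, by omega⟩)
        have e : x - (2 * n : ℕ) + (k : ℤ) = (x + k) - (2 * n : ℕ) := by ring
        rw [e]
        exact dvd_sub h dvd_rfl
    obtain ⟨f, hf, hfS⟩ := exists_of_set S hSsym k hSlt
    have hf0 : f 0 = k := by
      have h1 : (f 0 : ℤ) - 1 ∈ S := by rw [← hfS]; exact bd_zero_mem f
      have h2 := hSlt _ h1
      have h3 : (k : ℤ) - 1 ∈ MS f := by
        rw [hfS, hS1 _ (by simp)]
      have h4 := bd_zero_max hf h3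
      omega
    have hfc : ∀ x ∈ MS f, x - (2 * n : ℕ) ∈ MS f := by rw [hfS]; exact hScore
    refine ⟨f, (hsrc f).2 ⟨hf, hfc, hf0⟩, ?_⟩
    apply Phi_eq hn hf hg hfc hψ hneg (by rw [hf0]; exact hrange)
    intro y
    rw [hfS, hSψ]
end

section
/- Let a be a balanced flush abacus on 2n runners with coordinates (a_1,…,a_n,−a_n,…,−a_1), corresponding to an element of the type C_n parabolic quotient whose core has first part λ_1, and let s_{i_1}⋯s_{i_ℓ} be a reduced word for that element. Then among the generators s_{i_1},…,s_{i_ℓ} applied in sequence (right to left) to reduce a to the identity abacus, exactly λ_1 of the applications change the position of the largest runner. -/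
section Helpers

lemma aget_lt {r : ℕ} (a : Fin r → ℤ) {i : ℕ} (h : i < r) : aget r a i = a ⟨i, h⟩ := by
  simp [aget, h]

lemma swapIdx_lt {p q x r : ℕ} (hp : p < r) (hq : q < r) (hx : x < r) : swapIdx p q x < r := by
  unfold swapIdx; split_ifs <;> assumption

lemma gen_zero {n : ℕ} (a : Fin (2*n) → ℤ) {i : ℕ} (h : i < 2*n) :
    aget (2*n) (genAct n 0 a) i = if i = 0 then aget (2*n) a (2*n-1) + 1
      else if i = 2*n-1 then aget (2*n) a 0 - 1 else aget (2*n) a i := by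
  rw [aget_lt _ h]; simp only [genAct, if_true]; rw [aget_lt a h]

lemma gen_last {n : ℕ} (hn : 2 ≤ n) (a : Fin (2*n) → ℤ) {i : ℕ} (h : i < 2*n) :
    aget (2*n) (genAct n n a) i = aget (2*n) a (swapIdx (n-1) n i) := by
  rw [aget_lt _ h]; simp only [genAct, if_true]; rw [if_neg (by omega)]

lemma gen_mid {n t : ℕ} (ht : 1 ≤ t) (htn : t < n) (a : Fin (2*n) → ℤ) {i : ℕ} (h : i < 2*n) :
    aget (2*n) (genAct n t a) i =
      aget (2*n) a (swapIdx (t-1) t (swapIdx (2*n-1-t) (2*n-t) i)) := by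
  rw [aget_lt _ h]; simp only [genAct]; rw [if_neg (by omega), if_neg (by omega)]

lemma bal_iff {n : ℕ} (a : Fin (2*n) → ℤ) : BalancedAbacus n a ↔
    ∀ i < 2*n, aget (2*n) a i + aget (2*n) a (2*n-1-i) = 0 := by
  constructor
  · intro h i hi
    have := h ⟨i, hi⟩
    rw [aget_lt a hi, aget_lt a (show 2*n-1-i < 2*n by omega)]
    convert this using 3
    ext; simp [Fin.rev]; omega
  · intro h i
    have := h i i.2
    rw [aget_lt a i.2, aget_lt a (show 2*n-1-i.val < 2*n by omega)] at this
    convert this using 3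
    ext; simp [Fin.rev]; omega

lemma bal_gen {n t : ℕ} (hn : 2 ≤ n) (ht : t ≤ n) (a : Fin (2*n) → ℤ) (h : BalancedAbacus n a) :
    BalancedAbacus n (genAct n t a) := by
  rw [bal_iff] at *
  intro i hi
  have hi' : 2*n-1-i < 2*n := by omega
  rcases Nat.eq_zero_or_pos t with rfl | h0
  · rw [gen_zero a hi, gen_zero a hi']
    have h1 := h 0 (by omega)
    have h2 := h i hi
    simp only [Nat.sub_zero] at h1
    split_ifs <;> omega
  rcases Nat.lt_or_ge t n with h1 | h1
  · rw [gen_mid h0 h1 a hi, gen_mid h0 h1 a hi']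
    have key : swapIdx (t-1) t (swapIdx (2*n-1-t) (2*n-t) (2*n-1-i)) =
      2*n-1-(swapIdx (t-1) t (swapIdx (2*n-1-t) (2*n-t) i)) := by
      unfold swapIdx; split_ifs <;> omega
    rw [key]
    exact h _ (swapIdx_lt (by omega) (by omega) (swapIdx_lt (by omega) (by omega) hi))
  · obtain rfl : t = n := by omega
    rw [gen_last hn a hi, gen_last hn a hi']
    have key : swapIdx (t-1) t (2*t-1-i) = 2*t-1-(swapIdx (t-1) t i) := by
      unfold swapIdx; split_ifs <;> omega
    rw [key]
    exact h _ (swapIdx_lt (by omega) (by omega) hi)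

/-- Descent condition. -/
def Desc (n t : ℕ) (a : Fin (2*n) → ℤ) : Prop :=
  if t = 0 then 1 ≤ aget (2*n) a 0 else aget (2*n) a (t-1) < aget (2*n) a t

/-- `L` is the largest runner. -/
def IsLg (n : ℕ) (a : Fin (2*n) → ℤ) (L : ℕ) : Prop :=
  L < 2*n ∧ (∀ i < 2*n, aget (2*n) a i ≤ aget (2*n) a L) ∧
    ∀ i < 2*n, L < i → aget (2*n) a i < aget (2*n) a L

lemma isLg_largest {n : ℕ} (hn : 2 ≤ n) (a : Fin (2*n) → ℤ) :
    IsLg n a (largestRunner (2*n) a) := by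
  set S := {i : ℕ | ∃ h : i < 2*n, ∀ i', a i' ≤ a ⟨i, h⟩} with hS
  have hbdd : BddAbove S := ⟨2*n, fun i hi => hi.1.le⟩
  have : Nonempty (Fin (2*n)) := ⟨⟨0, by omega⟩⟩
  have hne : S.Nonempty := by
    obtain ⟨i, hi⟩ := Finite.exists_max a
    exact ⟨i.val, i.2, hi⟩
  obtain ⟨h1, h2⟩ := Nat.sSup_mem hne hbdd
  change IsLg n a (sSup S)
  refine ⟨h1, ?_, ?_⟩
  · intro i hi
    rw [aget_lt a hi, aget_lt a h1]; exact h2 _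
  · intro i hi hl
    by_contra hcon
    have : i ∈ S := by
      refine ⟨hi, fun i' => ?_⟩
      rw [aget_lt a hi, aget_lt a h1] at hcon
      exact (h2 i').trans (not_lt.mp hcon)
    have := le_csSup hbdd this
    omega

lemma isLg_unique {n : ℕ} {a : Fin (2*n) → ℤ} {L L' : ℕ} (h : IsLg n a L) (h' : IsLg n a L') :
    L = L' := by
  obtain ⟨h1, h2, h3⟩ := h
  obtain ⟨h1', h2', h3'⟩ := h'
  rcases lt_trichotomy L L' with hl | hl | hl
  · have := h3 _ h1' hl; have := h2' _ h1; omega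
  · exact hl
  · have := h3' _ h1 hl; have := h2 _ h1'; omega

lemma step_lg {n t : ℕ} (hn : 2 ≤ n) (ht : t ≤ n) (a : Fin (2*n) → ℤ) (h : BalancedAbacus n a)
    (hd : Desc n t a) {L : ℕ} (hL : IsLg n a L) :
    ∃ L', IsLg n (genAct n t a) L' ∧
      ((L' = L ∧ aget (2*n) (genAct n t a) L' = aget (2*n) a L) ∨
       (L' ≠ L ∧ 2*n*aget (2*n) (genAct n t a) L' + L' = 2*n*aget (2*n) a L + L - 1)) := by
  rw [bal_iff] at h
  obtain ⟨h1, h2, h3⟩ := hL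
  rcases Nat.eq_zero_or_pos t with rfl | h0
  · simp only [Desc, if_true] at hd
    have hb := h 0 (by omega)
    simp only [Nat.sub_zero] at hb
    have hL1 : L ≠ 2*n-1 := by
      rintro rfl
      have := h2 0 (by omega)
      omega
    by_cases hL0 : L = 0
    · subst hL0
      refine ⟨2*n-1, ⟨by omega, ?_, ?_⟩, Or.inr ⟨by omega, ?_⟩⟩
      · intro i hi
        rw [gen_zero a hi, gen_zero a (show 2*n-1 < 2*n by omega), if_neg (show 2*n-1 ≠ 0 by omega),
          if_pos rfl]
        split_ifs with c1 c2
        · omega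
        · omega
        · have := h3 i hi (by omega)
          omega
      · intro i hi hl; omega
      · rw [gen_zero a (show 2*n-1 < 2*n by omega), if_neg (show 2*n-1 ≠ 0 by omega), if_pos rfl]
        push_cast [show 1 ≤ 2*n by omega]
        ring
    · have hLL : aget (2*n) (genAct n 0 a) L = aget (2*n) a L := by
        rw [gen_zero a h1, if_neg hL0, if_neg hL1]
      refine ⟨L, ⟨h1, ?_, ?_⟩, Or.inl ⟨rfl, hLL⟩⟩
      · intro i hi
        rw [hLL, gen_zero a hi]
        have := h2 0 (by omega)
        have := h2 i hi
        split_ifs <;> omega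
      · intro i hi hl
        rw [hLL, gen_zero a hi]
        have := h2 0 (by omega)
        have := h3 i hi hl
        split_ifs <;> omega
  have hd' : aget (2*n) a (t-1) < aget (2*n) a t := by
    simpa [Desc, show t ≠ 0 by omega] using hd
  rcases Nat.lt_or_ge t n with ht' | ht'
  · have b1 := h t (by omega)
    have b2 := h (t-1) (by omega)
    rw [show 2*n-1-t = 2*n-1-t by rfl] at b1
    rw [show 2*n-1-(t-1) = 2*n-t by omega] at b2
    have n1 : L ≠ t-1 := by rintro rfl; have := h2 t (by omega); omega
    have n2 : L ≠ 2*n-1-t := by rintro rfl; have := h2 (2*n-t) (by omega); omega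
    have hle : ∀ i < 2*n, aget (2*n) (genAct n t a) i ≤ aget (2*n) a L := by
      intro i hi
      rw [gen_mid h0 ht' a hi]
      exact h2 _ (swapIdx_lt (by omega) (by omega) (swapIdx_lt (by omega) (by omega) hi))
    by_cases hc : L = t ∨ L = 2*n-t
    · have hLL : aget (2*n) (genAct n t a) (L-1) = aget (2*n) a L := by
        rw [gen_mid h0 ht' a (by omega)]
        congr 1
        unfold swapIdx; split_ifs <;> omega
      refine ⟨L-1, ⟨by omega, ?_, ?_⟩, Or.inr ⟨by omega, ?_⟩⟩
      · rw [hLL]; exact hle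
      · intro i hi hl
        rw [hLL, gen_mid h0 ht' a hi]
        by_cases hiL : i = L
        · subst hiL
          rcases hc with rfl | rfl
          · rw [show swapIdx (i-1) i (swapIdx (2*n-1-i) (2*n-i) i) = i-1 by
              unfold swapIdx; split_ifs <;> omega]
            exact hd'
          · rw [show swapIdx (t-1) t (swapIdx (2*n-1-t) (2*n-t) (2*n-t)) = 2*n-1-t by
              unfold swapIdx; split_ifs <;> omega]
            omega
        · apply h3 _ (swapIdx_lt (by omega) (by omega) (swapIdx_lt (by omega) (by omega) hi))
          unfold swapIdx; split_ifs <;> omega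
      · rw [hLL]; push_cast [show 1 ≤ L by omega]; ring
    · have hLL : aget (2*n) (genAct n t a) L = aget (2*n) a L := by
        rw [gen_mid h0 ht' a (by omega)]
        congr 1
        unfold swapIdx; split_ifs <;> omega
      refine ⟨L, ⟨by omega, ?_, ?_⟩, Or.inl ⟨rfl, hLL⟩⟩
      · rw [hLL]; exact hle
      · intro i hi hl
        rw [hLL, gen_mid h0 ht' a hi]
        apply h3 _ (swapIdx_lt (by omega) (by omega) (swapIdx_lt (by omega) (by omega) hi))
        unfold swapIdx; split_ifs <;> omega
  · obtain rfl : t = n := by omega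
    have n1 : L ≠ t-1 := by rintro rfl; have := h2 t (by omega); omega
    have hle : ∀ i < 2*t, aget (2*t) (genAct t t a) i ≤ aget (2*t) a L := by
      intro i hi
      rw [gen_last hn a hi]
      exact h2 _ (swapIdx_lt (by omega) (by omega) hi)
    by_cases hc : L = t
    · have hLL : aget (2*t) (genAct t t a) (L-1) = aget (2*t) a L := by
        rw [gen_last hn a (by omega)]
        congr 1
        unfold swapIdx; split_ifs <;> omega
      refine ⟨L-1, ⟨by omega, ?_, ?_⟩, Or.inr ⟨by omega, ?_⟩⟩
      · rw [hLL]; exact hle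
      · intro i hi hl
        rw [hLL, gen_last hn a hi]
        by_cases hiL : i = L
        · subst hiL
          subst hc
          rw [show swapIdx (i-1) i i = i-1 by unfold swapIdx; split_ifs <;> omega]
          exact hd'
        · apply h3 _ (swapIdx_lt (by omega) (by omega) hi)
          unfold swapIdx; split_ifs <;> omega
      · rw [hLL]; push_cast [show 1 ≤ L by omega]; ring
    · have hLL : aget (2*t) (genAct t t a) L = aget (2*t) a L := by
        rw [gen_last hn a (by omega)]
        congr 1
        unfold swapIdx; split_ifs <;> omega
      refine ⟨L, ⟨by omega, ?_, ?_⟩, Or.inl ⟨rfl, hLL⟩⟩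
      · rw [hLL]; exact hle
      · intro i hi hl
        rw [hLL, gen_last hn a hi]
        apply h3 _ (swapIdx_lt (by omega) (by omega) hi)
        unfold swapIdx; split_ifs <;> omega

/-- Number of hyperplanes of a given root direction that are crossed. -/
def pcr (d : ℤ) : ℤ := if 0 < d then d - 1 else -d

lemma pcr_nonneg (d : ℤ) : 0 ≤ pcr d := by unfold pcr; split_ifs <;> omega

/-- Pair contribution. -/
def phi (x y : ℤ) : ℤ := pcr (x - y) + pcr (x + y)

/-- Explicit length function on half the level vector. -/
def lenX (n : ℕ) (x : Fin n → ℤ) : ℤ :=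
  ∑ i, pcr (2 * x i) + ∑ i, ∑ j, if i < j then phi (x i) (x j) else 0

lemma lenX_nonneg (n : ℕ) (x : Fin n → ℤ) : 0 ≤ lenX n x := by
  unfold lenX
  refine add_nonneg (Finset.sum_nonneg fun i _ => pcr_nonneg _)
    (Finset.sum_nonneg fun i _ => Finset.sum_nonneg fun j _ => ?_)
  split_ifs
  · exact add_nonneg (pcr_nonneg _) (pcr_nonneg _)
  · exact le_rfl

lemma lenX_swap {n : ℕ} (x : Fin n → ℤ) (p q : Fin n) (hpq : p.val + 1 = q.val) :
    lenX n (x ∘ Equiv.swap p q) = lenX n x + phi (x q) (x p) - phi (x p) (x q) := by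
  have hne : p ≠ q := by intro h; rw [h] at hpq; omega
  unfold lenX
  have e1 : ∑ i, pcr (2 * (x ∘ Equiv.swap p q) i) = ∑ i, pcr (2 * x i) :=
    Equiv.sum_comp (Equiv.swap p q) (fun i => pcr (2 * x i))
  have e2 : (∑ i, ∑ j, if i < j then phi ((x ∘ Equiv.swap p q) i) ((x ∘ Equiv.swap p q) j) else 0)
      = ∑ i, ∑ j, if Equiv.swap p q i < Equiv.swap p q j then phi (x i) (x j) else 0 := by
    rw [← Equiv.sum_comp (Equiv.swap p q)]
    refine Finset.sum_congr rfl fun i _ => ?_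
    rw [← Equiv.sum_comp (Equiv.swap p q)]
    simp
  have e3 : ∀ i j, (if Equiv.swap p q i < Equiv.swap p q j then phi (x i) (x j) else 0) =
      (if i < j then phi (x i) (x j) else 0) + (if i = p then if j = q then - phi (x p) (x q) else 0 else 0)
       + (if i = q then if j = p then phi (x q) (x p) else 0 else 0) := by
    intro i j
    have hv : ∀ k l : Fin n, k = l ↔ k.val = l.val := fun k l => Fin.ext_iff
    by_cases hip : i = p
    · subst hip
      by_cases hjq : j = q
      · subst hjq
        have c1 : i < j := by rw [Fin.lt_def]; omega
        have c2 : ¬ j < i := by rw [Fin.lt_def]; omega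
        simp [hne, c1, c2]
      · by_cases hji : j = i
        · subst hji; simp [hne]
        · rw [Equiv.swap_apply_left, Equiv.swap_apply_of_ne_of_ne hji hjq]
          rw [hv] at hji hjq
          have : (q < j) ↔ i < j := by simp only [Fin.lt_def]; omega
          simp [this, hne, hv, hji, hjq]
    · by_cases hiq : i = q
      · subst hiq
        by_cases hjp : j = p
        · subst hjp
          have c1 : j < i := by rw [Fin.lt_def]; omega
          have c2 : ¬ i < j := by rw [Fin.lt_def]; omega
          simp [hne.symm, c1, c2]
        · by_cases hji : j = i
          · subst hji; simp [hne.symm]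
          · rw [Equiv.swap_apply_right, Equiv.swap_apply_of_ne_of_ne hjp hji]
            rw [hv] at hji hjp
            have : (p < j) ↔ i < j := by simp only [Fin.lt_def]; omega
            simp [this, hne.symm, hv, hji, hjp]
      · rw [Equiv.swap_apply_of_ne_of_ne hip hiq, if_neg hip, if_neg hiq]
        simp only [add_zero]
        rw [hv] at hip hiq
        by_cases hjp : j = p
        · subst hjp
          rw [Equiv.swap_apply_left]
          have : (i < q) ↔ i < j := by simp only [Fin.lt_def]; omega
          simp [this]
        · by_cases hjq : j = q
          · subst hjq
            rw [Equiv.swap_apply_right]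
            have : (i < p) ↔ i < j := by simp only [Fin.lt_def]; omega
            simp [this]
          · rw [Equiv.swap_apply_of_ne_of_ne hjp hjq]
  rw [e1, e2]
  simp only [e3, Finset.sum_add_distrib, Finset.sum_ite_irrel, Finset.sum_ite_eq', Finset.mem_univ,
    if_true, Finset.sum_const_zero]
  ring

lemma lenX_update {n : ℕ} (x y : Fin n → ℤ) (p : Fin n) (hne : ∀ i, i ≠ p → y i = x i)
    (h1 : ∀ j, p < j → phi (y p) (x j) = phi (x p) (x j))
    (h2 : ∀ i, i < p → phi (x i) (y p) = phi (x i) (x p)) :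
    lenX n y = lenX n x + pcr (2 * y p) - pcr (2 * x p) := by
  unfold lenX
  have e2 : (∑ i, ∑ j, if i < j then phi (y i) (y j) else 0) =
      ∑ i, ∑ j, if i < j then phi (x i) (x j) else 0 := by
    refine Finset.sum_congr rfl fun i _ => Finset.sum_congr rfl fun j _ => ?_
    split_ifs with hij
    · by_cases hi : i = p
      · subst hi; rw [hne j hij.ne', h1 j hij]
      · rw [hne i hi]
        by_cases hj : j = p
        · subst hj; rw [h2 i hij]
        · rw [hne j hj]
    · rfl
  have e1 : ∑ i, pcr (2 * y i) = ∑ i, pcr (2 * x i) + pcr (2 * y p) - pcr (2 * x p) := by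
    rw [← Finset.add_sum_erase _ _ (Finset.mem_univ p),
      ← Finset.add_sum_erase _ (fun i => pcr (2 * x i)) (Finset.mem_univ p)]
    rw [Finset.sum_congr rfl (fun i hi => by rw [hne i (Finset.ne_of_mem_erase hi)] :
      ∀ i ∈ Finset.univ.erase p, pcr (2 * y i) = pcr (2 * x i))]
    ring
  rw [e1, e2]; ring

/-- The left half of the level vector. -/
def halfv (n : ℕ) (a : Fin (2*n) → ℤ) : Fin n → ℤ := fun i => aget (2*n) a i.val

/-- Explicit length. -/
def lenA (n : ℕ) (a : Fin (2*n) → ℤ) : ℤ := lenX n (halfv n a)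

lemma lenA_step {n t : ℕ} (hn : 2 ≤ n) (ht : t ≤ n) (a : Fin (2*n) → ℤ) (h : BalancedAbacus n a) :
    (Desc n t a → lenA n (genAct n t a) = lenA n a - 1) ∧
    (¬ Desc n t a → lenA n a ≤ lenA n (genAct n t a)) := by
  rw [bal_iff] at h
  rcases Nat.eq_zero_or_pos t with rfl | h0
  · have hb := h 0 (by omega)
    simp only [Nat.sub_zero] at hb
    have hy : halfv n (genAct n 0 a) ⟨0, by omega⟩ = 1 - halfv n a ⟨0, by omega⟩ := by
      simp only [halfv]
      rw [gen_zero a (by omega), if_pos rfl]; omega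
    have := lenX_update (halfv n a) (halfv n (genAct n 0 a)) ⟨0, by omega⟩ (by
        intro i hi
        have : i.val ≠ 0 := fun hh => hi (Fin.ext hh)
        simp only [halfv]
        rw [gen_zero a (by omega), if_neg this, if_neg (by omega)])
      (by
        intro j _
        rw [hy]; unfold phi pcr
        split_ifs <;> omega)
      (by intro i hi; simp [Fin.lt_def] at hi)
    unfold lenA
    rw [this, hy]
    simp only [Desc, if_true, halfv, pcr]
    constructor <;> intro hd <;> split_ifs <;> omega
  have hD : Desc n t a ↔ aget (2*n) a (t-1) < aget (2*n) a t := by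
    simp [Desc, show t ≠ 0 by omega]
  rw [hD]
  rcases Nat.lt_or_ge t n with ht' | ht'
  · have : halfv n (genAct n t a) = halfv n a ∘ Equiv.swap ⟨t-1, by omega⟩ ⟨t, ht'⟩ := by
      funext i
      simp only [halfv, Function.comp]
      rw [gen_mid h0 ht' a (by omega)]
      congr 1
      rw [Equiv.swap_apply_def]
      have hi := i.2
      unfold swapIdx
      simp only [Fin.ext_iff]
      split_ifs <;> (try dsimp only) <;> omega
    unfold lenA
    rw [this, lenX_swap _ _ _ (by dsimp only; omega)]
    simp only [halfv, phi, pcr]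
    constructor <;> intro hd <;> split_ifs <;> omega
  · obtain rfl : t = n := by omega
    have hb := h t (by omega)
    rw [show 2*t-1-t = t-1 by omega] at hb
    have hy : halfv t (genAct t t a) ⟨t-1, by omega⟩ = - halfv t a ⟨t-1, by omega⟩ := by
      simp only [halfv]
      rw [gen_last hn a (by omega), show swapIdx (t-1) t (t-1) = t by simp [swapIdx]]; omega
    have := lenX_update (halfv t a) (halfv t (genAct t t a)) ⟨t-1, by omega⟩ (by
        intro i hi
        have : i.val ≠ t-1 := fun hh => hi (Fin.ext hh)
        have hi2 := i.2
        simp only [halfv]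
        rw [gen_last hn a (by omega)]
        congr 1
        unfold swapIdx; split_ifs <;> omega)
      (by intro i hi; simp only [Fin.lt_def] at hi; have := i.2; omega)
      (by
        intro j _
        rw [hy]; unfold phi
        rw [sub_neg_eq_add, ← sub_eq_add_neg, add_comm])
    unfold lenA
    rw [this, hy]
    simp only [halfv, pcr]
    constructor <;> intro hd <;> split_ifs <;> omega

lemma exists_desc {n : ℕ} (hn : 2 ≤ n) (a : Fin (2*n) → ℤ) (h : BalancedAbacus n a) (ha : a ≠ 0) :
    ∃ t ≤ n, Desc n t a := by
  by_contra hcon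
  push Not at hcon
  apply ha
  rw [bal_iff] at h
  have h0 : aget (2*n) a 0 ≤ 0 := by
    have := hcon 0 (by omega); simp [Desc] at this; omega
  have hs : ∀ t, t + 1 ≤ n → aget (2*n) a (t+1) ≤ aget (2*n) a t := by
    intro t ht
    have := hcon (t+1) ht; simpa [Desc] using this
  have hl : 0 ≤ aget (2*n) a (n-1) := by
    have h1 := hs (n-1) (by omega)
    have h2 := h n (by omega)
    rw [show 2*n-1-n = n-1 by omega] at h2
    rw [show n-1+1 = n by omega] at h1
    omega
  have up : ∀ t, t < n → aget (2*n) a t ≤ 0 := by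
    intro t
    induction t with
    | zero => intro _; exact h0
    | succ k ih => intro hk; exact (hs k (by omega)).trans (ih (by omega))
  have dn : ∀ k, k < n → 0 ≤ aget (2*n) a (n-1-k) := by
    intro k
    induction k with
    | zero => intro _; exact hl
    | succ k ih =>
      intro hk
      have h1 := hs (n-1-(k+1)) (by omega)
      rw [show n-1-(k+1)+1 = n-1-k by omega] at h1
      exact (ih (by omega)).trans h1
  have z : ∀ t, t < n → aget (2*n) a t = 0 := by
    intro t ht
    have h1 := dn (n-1-t) (by omega)
    rw [show n-1-(n-1-t) = t by omega] at h1
    have := up t ht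
    omega
  funext i
  rw [← aget_lt a i.2]
  by_cases hi : i.val < n
  · exact z _ hi
  · have h1 := h i i.2
    have h2 := z (2*n-1-i.val) (by omega)
    simp only [Pi.zero_apply]
    omega

lemma exists_word {n : ℕ} (hn : 2 ≤ n) : ∀ (k : ℕ) (a : Fin (2*n) → ℤ), BalancedAbacus n a →
    lenA n a = k → ∃ w : List ℕ, (∀ t ∈ w, t ≤ n) ∧ applyWord n w a = 0 ∧ w.length ≤ k := by
  intro k
  induction k with
  | zero =>
    intro a h hk
    by_cases ha : a = 0
    · exact ⟨[], by simp, by simpa [applyWord] using ha, by simp⟩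
    · obtain ⟨t, ht, hd⟩ := exists_desc hn a h ha
      have := (lenA_step hn ht a h).1 hd
      have h2 : 0 ≤ lenA n (genAct n t a) := lenX_nonneg _ _
      push_cast at hk
      omega
  | succ k ih =>
    intro a h hk
    by_cases ha : a = 0
    · exact ⟨[], by simp, by simpa [applyWord] using ha, by simp⟩
    · obtain ⟨t, ht, hd⟩ := exists_desc hn a h ha
      have h1 := (lenA_step hn ht a h).1 hd
      obtain ⟨w, w1, w2, w3⟩ := ih (genAct n t a) (bal_gen hn ht a h) (by rw [h1, hk]; push_cast; ring)
      refine ⟨t :: w, ?_, ?_, ?_⟩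
      · intro s hs
        rcases List.mem_cons.mp hs with rfl | hs
        · exact ht
        · exact w1 s hs
      · simpa [applyWord] using w2
      · simpa using w3

lemma lenA_zero (n : ℕ) : lenA n 0 = 0 := by
  have : halfv n 0 = fun _ => 0 := by funext i; simp [halfv, aget]
  unfold lenA
  rw [this]
  simp [lenX, phi, pcr]

lemma lenA_le {n : ℕ} (hn : 2 ≤ n) : ∀ (w : List ℕ) (a : Fin (2*n) → ℤ), BalancedAbacus n a →
    (∀ t ∈ w, t ≤ n) → applyWord n w a = 0 → lenA n a ≤ w.length := by
  intro w
  induction w with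
  | nil =>
    intro a h _ h0
    have : a = 0 := by simpa [applyWord] using h0
    rw [this, lenA_zero]; simp
  | cons t w ih =>
    intro a h hw h0
    have ht : t ≤ n := hw t (by simp)
    have h1 := ih (genAct n t a) (bal_gen hn ht a h) (fun s hs => hw s (by simp [hs]))
      (by simpa [applyWord] using h0)
    have h2 := lenA_step hn ht a h
    simp only [List.length_cons]; push_cast
    by_cases hd : Desc n t a
    · have := h2.1 hd; omega
    · have := h2.2 hd; omega

/-- Position statistic of the largest bead. -/
noncomputable def posA (n : ℕ) (a : Fin (2*n) → ℤ) : ℤ :=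
  2*n*aget (2*n) a (largestRunner (2*n) a) + largestRunner (2*n) a - (2*n-1)

lemma count_eq {n : ℕ} (hn : 2 ≤ n) : ∀ (w : List ℕ) (a : Fin (2*n) → ℤ), BalancedAbacus n a →
    (∀ t ∈ w, t ≤ n) → applyWord n w a = 0 → (w.length : ℤ) ≤ lenA n a →
    (∑ j ∈ Finset.range w.length, if largestRunner (2*n) (applyWord n (w.take (j+1)) a)
          ≠ largestRunner (2*n) (applyWord n (w.take j) a) then (1:ℤ) else 0) = posA n a := by
  intro w
  induction w with
  | nil =>
    intro a h _ h0 _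
    have : a = 0 := by simpa [applyWord] using h0
    subst this
    have hz : ∀ i, aget (2*n) 0 i = 0 := by intro i; simp [aget]
    have : IsLg n 0 (2*n-1) := ⟨by omega, by simp [hz], by intro i hi hl; omega⟩
    have hl := isLg_unique (isLg_largest hn 0) this
    unfold posA
    rw [hl, hz]
    push_cast [show 1 ≤ 2*n by omega]
    simp
  | cons t w ih =>
    intro a h hw h0 hlen
    have ht : t ≤ n := hw t (by simp)
    have hw' : ∀ s ∈ w, s ≤ n := fun s hs => hw s (by simp [hs])
    have hb := bal_gen hn ht a h
    have h0' : applyWord n w (genAct n t a) = 0 := by simpa [applyWord] using h0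
    have h1 := lenA_le hn w _ hb hw' h0'
    have h2 := lenA_step hn ht a h
    simp only [List.length_cons] at hlen; push_cast at hlen
    have hd : Desc n t a := by
      by_contra hd
      -- parity-free argument: a non-descent cannot shorten
      have := h2.2 hd; omega
    have h3 := h2.1 hd
    have h4 := ih _ hb hw' h0' (by omega)
    simp only [List.length_cons]
    rw [Finset.sum_range_succ']
    have e : ∀ j, applyWord n ((t :: w).take (j+1)) a = applyWord n (w.take j) (genAct n t a) := by
      intro j; simp [applyWord]
    simp only [e]
    rw [h4]
    have e0 : applyWord n (w.take 0) (genAct n t a) = genAct n t a := by simp [applyWord]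
    have e1 : applyWord n ((t :: w).take 0) a = a := by simp [applyWord]
    rw [e0, e1]
    obtain ⟨L', hL', hc⟩ := step_lg hn ht a h hd (isLg_largest hn a)
    have hu := isLg_unique (isLg_largest hn (genAct n t a)) hL'
    unfold posA
    rw [hu]
    rcases hc with ⟨c1, c2⟩ | ⟨c1, c2⟩
    · rw [if_neg (by simpa using c1), c2, c1]; ring
    · rw [if_pos c1, c2]; ring

lemma core_aux {r : ℕ} (a : Fin r → ℤ) (hsum0 : ∑ i, a i = 0) (L : ℕ) (hL : L < r)
    (h2 : ∀ i < r, aget r a i ≤ aget r a L) (h3 : ∀ i < r, L < i → aget r a i < aget r a L) :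
    (abacusCore r a 0 : ℤ) = r * aget r a L + L - (r - 1) := by
  set m := aget r a L with hm
  have h2' : ∀ i : Fin r, a i ≤ m := fun i => by rw [← aget_lt a i.2]; exact h2 i i.2
  have h3' : ∀ i : Fin r, L < i.val → a i ≤ m - 1 := fun i hi => by
    have := h3 i i.2 hi
    rw [aget_lt a i.2] at this
    have : a i < m := this
    omega
  have hmL : a ⟨L, hL⟩ = m := by rw [hm, aget_lt a hL]
  set V : ℤ := (r+1)*m + (L+1) with hV
  have hmod : ∀ (k : ℤ) (i : Fin r), ((r+1 : ℤ)*k + (i.val+1)) % (r+1) = (i.val:ℤ)+1 := by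
    intro k i
    have := i.2
    rw [Int.mul_add_emod_self_left]
    exact Int.emod_eq_of_lt (by omega) (by omega)
  have hmono : ∀ k k' : ℤ, k ≤ k' → (r+1 : ℤ)*k ≤ (r+1)*k' := fun k k' hk =>
    mul_le_mul_of_nonneg_left hk (by omega)
  have hVb : IsBead r a V := ⟨⟨L, hL⟩, hmod m ⟨L, hL⟩, by rw [hmL]⟩
  have hVmax : ∀ b, IsBead r a b → b ≤ V := by
    rintro b ⟨i, _, hi⟩
    refine hi.trans ?_
    by_cases hiL : L < i.val
    · have q := hmono _ _ (h3' i hiL)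
      have : (r+1 : ℤ)*(m-1) = (r+1)*m - (r+1) := by ring
      have := i.2
      omega
    · have q := hmono _ _ (h2' i)
      omega
  have hset : {g : ℤ | IsGap r a g ∧ ∃ b : ℤ, IsBead r a b ∧
      Nat.card {b' : ℤ | IsBead r a b' ∧ b < b'} = 0 ∧ g < b} =
      (((Finset.univ : Finset (Fin r)).sigma fun i =>
        Finset.Ioc (a i) (if i.val ≤ L then m else m-1)).image
          (fun p => (r+1 : ℤ)*p.2 + (p.1.val+1)) : Finset ℤ) := by
    ext g
    simp only [Set.mem_ofPred_eq, Finset.coe_image, Set.mem_image, Finset.mem_coe, Finset.mem_sigma,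
      Finset.mem_univ, true_and, Finset.mem_Ioc]
    constructor
    · rintro ⟨⟨g0, g1⟩, b, hb, _, hgb⟩
      have hgV : g < V := lt_of_lt_of_le hgb (hVmax b hb)
      have p0 := Int.emod_nonneg g (show (r+1 : ℤ) ≠ 0 by omega)
      have p1 := Int.emod_lt_of_pos g (show (0:ℤ) < r+1 by omega)
      have p2 := Int.mul_ediv_add_emod g (r+1)
      set ρ := g % (r+1) with hρ
      set k := g / (r+1) with hk
      have hi : (ρ - 1).toNat < r := by omega
      have hiv : (((ρ - 1).toNat : ℕ) : ℤ) = ρ - 1 := by omega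
      refine ⟨⟨⟨(ρ - 1).toNat, hi⟩, k⟩, ⟨?_, ?_⟩, ?_⟩
      · by_contra hcon
        have := hmono _ _ (not_lt.mp hcon)
        apply g1
        refine ⟨⟨(ρ - 1).toNat, hi⟩, ?_, ?_⟩
        · simp only [hiv]; omega
        · simp only [hiv] at *; omega
      · by_contra hcon
        simp only at hcon
        split_ifs at hcon with hc
        · have := hmono (m+1) k (by omega)
          have : (r+1 : ℤ)*(m+1) = (r+1)*m + (r+1) := by ring
          omega
        · have := hmono m k (by omega)
          omega
      · simp only [hiv]; omega
    · rintro ⟨⟨i, k⟩, ⟨k1, k2⟩, rfl⟩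
      simp only at k1 k2 ⊢
      have hiL := i.2
      refine ⟨⟨by rw [hmod]; omega, ?_⟩, V, hVb, ?_, ?_⟩
      · rintro ⟨j, j1, j2⟩
        rw [hmod] at j1
        have : j = i := by ext; omega
        subst this
        have := hmono (a j + 1) k (by omega)
        have : (r+1 : ℤ)*(a j+1) = (r+1)*a j + (r+1) := by ring
        omega
      · have : {b' : ℤ | IsBead r a b' ∧ V < b'} = ∅ := by
          ext b'
          simp only [Set.mem_ofPred_eq, Set.mem_empty_iff_false, iff_false, not_and, not_lt]
          exact hVmax b'
        rw [this]; simp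
      · split_ifs at k2 with hc
        · have : i.val ≠ L := by
            intro hh
            have : a i = m := by rw [← hmL]; congr 1; exact Fin.ext hh
            omega
          have := hmono _ _ k2
          omega
        · have := hmono _ _ k2
          have : (r+1 : ℤ)*(m-1) = (r+1)*m - (r+1) := by ring
          omega
  have hinj : Set.InjOn (fun p : (_ : Fin r) × ℤ => (r+1 : ℤ)*p.2 + (p.1.val+1)) 
      (((Finset.univ : Finset (Fin r)).sigma fun i =>
        Finset.Ioc (a i) (if i.val ≤ L then m else m-1) : Finset _) : Set ((_ : Fin r) × ℤ)) := by
    rintro ⟨i, k⟩ _ ⟨j, l⟩ _ he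
    simp only at he
    have e1 := congrArg (· % (r+1 : ℤ)) he
    simp only [hmod] at e1
    have hij : i = j := by ext; omega
    subst hij
    have : k = l := by
      have : (r+1 : ℤ)*k = (r+1)*l := by omega
      exact mul_left_cancel₀ (by omega) this
    rw [this]
  unfold abacusCore
  rw [hset, Nat.card_coe_set_eq, Set.ncard_coe_finset, Finset.card_image_of_injOn hinj,
    Finset.card_sigma]
  push_cast
  have hterm : ∀ i : Fin r, ((Finset.Ioc (a i) (if i.val ≤ L then m else m-1)).card : ℤ) =
      m - a i - (if i.val ≤ L then 0 else 1) := by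
    intro i
    rw [Int.card_Ioc]
    have := h2' i
    split_ifs with hc
    · omega
    · have := h3' i (by omega)
      omega
  rw [Finset.sum_congr rfl fun i _ => hterm i]
  rw [Finset.sum_sub_distrib, Finset.sum_sub_distrib, hsum0]
  have hcnt : (∑ i : Fin r, if i.val ≤ L then (0:ℤ) else 1) = r - (L+1) := by
    rw [Fin.sum_univ_eq_sum_range (fun i => if i ≤ L then (0:ℤ) else 1) r]
    obtain ⟨d, hd⟩ := Nat.exists_eq_add_of_lt hL
    rw [show r = (L+1) + d by omega, Finset.sum_range_add]
    rw [Finset.sum_eq_zero (fun i hi => by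
      rw [if_pos]; have := Finset.mem_range.mp hi; omega)]
    rw [Finset.sum_congr rfl (fun i _ => by rw [if_neg (by omega)] :
      ∀ i ∈ Finset.range d, (if L+1+i ≤ L then (0:ℤ) else 1) = 1)]
    simp
  rw [hcnt]
  simp only [Finset.sum_const, Finset.card_univ, Fintype.card_fin, nsmul_eq_mul]
  ring

lemma core_eq {n : ℕ} (hn : 2 ≤ n) (a : Fin (2*n) → ℤ) (h : BalancedAbacus n a) :
    (abacusCore (2*n) a 0 : ℤ) = posA n a := by
  obtain ⟨hL, h2, h3⟩ := isLg_largest hn a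
  have hsum0 : ∑ i, a i = 0 := by
    have h1 : ∑ i : Fin (2*n), a i.rev = ∑ i, a i := Equiv.sum_comp Fin.revPerm a
    have h2 : ∑ i : Fin (2*n), (a i + a i.rev) = 0 := Finset.sum_eq_zero fun i _ => h i
    rw [Finset.sum_add_distrib, h1] at h2
    omega
  rw [core_aux a hsum0 _ hL h2 h3]
  unfold posA
  push_cast
  rfl

end Helpers

/-- Let `a` be a balanced flush abacus on `2n` runners whose core has first part `λ₁`, and
let `w = s_{i₁} ⋯ s_{i_ℓ}` be a reduced word for the corresponding coset representative,
so that applying the letters of `w` in order carries `a` to the identity abacus.  Then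
exactly `λ₁` of the `ℓ` applications change the position of the largest runner. -/
theorem stmt18 (n : ℕ) (hn : 2 ≤ n) (a : Fin (2*n) → ℤ) (hbal : BalancedAbacus n a)
    (w : List ℕ) (hw : ∀ t ∈ w, t ≤ n)
    (hid : applyWord n w a = 0)
    (hred : ∀ w' : List ℕ, (∀ t ∈ w', t ≤ n) → applyWord n w' a = 0 →
      w.length ≤ w'.length) :
    Nat.card {j : ℕ | j < w.length ∧
        largestRunner (2*n) (applyWord n (w.take (j+1)) a)
          ≠ largestRunner (2*n) (applyWord n (w.take j) a)}
      = abacusCore (2*n) a 0 := by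
  obtain ⟨k, hk⟩ := Int.eq_ofNat_of_zero_le (show 0 ≤ lenA n a from lenX_nonneg _ _)
  obtain ⟨w', w1, w2, w3⟩ := exists_word hn k a hbal hk
  have hlen : (w.length : ℤ) ≤ lenA n a := by
    have := hred w' w1 w2
    omega
  have hc := count_eq hn w a hbal hw hid hlen
  rw [← core_eq hn a hbal] at hc
  have hs : {j : ℕ | j < w.length ∧
        largestRunner (2*n) (applyWord n (w.take (j+1)) a)
          ≠ largestRunner (2*n) (applyWord n (w.take j) a)} =
      ((Finset.range w.length).filter fun j =>
        largestRunner (2*n) (applyWord n (w.take (j+1)) a)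
          ≠ largestRunner (2*n) (applyWord n (w.take j) a) : Finset ℕ) := by
    ext j; simp
  rw [hs, Nat.card_coe_set_eq, Set.ncard_coe_finset]
  rw [Finset.sum_boole] at hc
  exact_mod_cast hc
end
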